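/- Let k be a field, A a finite-dimensional self-injective k-algebra, and M a finitely generated A-module that is a generator, self-orthogonal and Nakayama-stable. Then the following are equivalent: (i) M is projective; (ii) every module in 𝒢 ∩ 𝒮 lies in Add(M); (iii) every module in ℰ ∩ 𝒮 lies in Add(M). (Corollary: vanishing of the relative stable categories (𝒢∩𝒮)/[M] and (ℰ∩𝒮)/[M] is equivalent to M being projective.) -/

import Mathlib

open CategoryTheory
/-! ## Additive closure classes -/

section AddClosure

variable (A : Type) [Ring A]

/-- `X ∈ add M`: `X` is a direct summand of a finite direct sum of copies of `M`. -/
def MemAdd (M X : ModuleCat.{0} A) : Prop :=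
  ∃ (n : ℕ) (Y : ModuleCat.{0} A), Nonempty ((↥X × ↥Y) ≃ₗ[A] (Fin n → ↥M))

/-- `X ∈ Add M`: `X` is a direct summand of an arbitrary direct sum of copies of `M`. -/
def MemAddBig (M X : ModuleCat.{0} A) : Prop :=
  ∃ (I : Type) (Y : ModuleCat.{0} A), Nonempty ((↥X × ↥Y) ≃ₗ[A] (I →₀ ↥M))

/-- a morphism of `A`-modules factors through a projective module -/
def FactorsThroughProj {X Y : ModuleCat.{0} A} (f : X ⟶ Y) : Prop :=
  ∃ (P : ModuleCat.{0} A) (_ : Module.Projective A P) (g : X ⟶ P) (h : P ⟶ Y), f = g ≫ h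

/-- a morphism of `A`-modules factors through a module in `Add M` -/
def FactorsThroughAddM (M : ModuleCat.{0} A) {X Y : ModuleCat.{0} A} (f : X ⟶ Y) : Prop :=
  ∃ (Z : ModuleCat.{0} A) (_ : MemAddBig A M Z) (g : X ⟶ Z) (h : Z ⟶ Y), f = g ≫ h

/-- `X ∈ add M` for unbundled modules. -/
def MemAddPlain (M : Type) [AddCommGroup M] [Module A M]
    (X : Type) [AddCommGroup X] [Module A X] : Prop :=
  ∃ (n : ℕ) (Y : ModuleCat.{0} A), Nonempty ((X × ↥Y) ≃ₗ[A] (Fin n → M))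

end AddClosure

/-! ## Ext vanishing -/

section ExtDefs

variable (A : Type) [Ring A]

/-- vanishing of `Ext^n_A(X, Y)` -/
noncomputable def extZero (n : ℕ) (X Y : ModuleCat.{0} A) : Prop :=
  Subsingleton (((Ext ℤ (ModuleCat.{0} A) n).obj (Opposite.op X)).obj Y)

/-- `M` is self-orthogonal: `Ext^n_A(M,M) = 0` for all `n ≥ 1`. -/
noncomputable def SelfOrthogonal (M : ModuleCat.{0} A) : Prop :=
  ∀ n : ℕ, 1 ≤ n → extZero A n M M

/-- `M` is a generator for `A`-mod: `A ∈ add M`. -/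
def IsGen (M : ModuleCat.{0} A) : Prop :=
  MemAdd A M (ModuleCat.of A A)

/-- membership in the `M`-Gorenstein subcategory `𝒢`:
`Ext^n_A(M,X) = 0 = Ext^n_A(X,M)` for all `n ≥ 1`. -/
noncomputable def MemG (M X : ModuleCat.{0} A) : Prop :=
  ∀ n : ℕ, 1 ≤ n → extZero A n M X ∧ extZero A n X M

end ExtDefs

/-! ## The Nakayama functor `ν_A = D ∘ Hom_A(-, A)` -/

section Nakayama

variable (k A : Type) [Field k] [Ring A] [Algebra k A]

/-- Right multiplication by `a : A` on `Hom_A(X, A)`, as a `k`-linear map. -/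
@[simps] def rmulHom (X : Type) [AddCommGroup X] [Module A X] (a : A) :
    (X →ₗ[A] A) →ₗ[k] (X →ₗ[A] A) where
  toFun f :=
    { toFun := fun x => f x * a
      map_add' := fun x y => by simp [add_mul]
      map_smul' := fun c x => by simp [mul_assoc] }
  map_add' f g := by ext x; simp [add_mul]
  map_smul' c f := by ext x; simp [Algebra.smul_def, mul_assoc]

/-- The carrier of the Nakayama functor value `ν_A(X) = D(Hom_A(X,A))`,
where `D = Hom_k(-,k)`. -/
abbrev NuCarrier (X : Type) [AddCommGroup X] [Module A X] : Type :=
  (X →ₗ[A] A) →ₗ[k] k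

/-- The left `A`-module structure on `ν_A(X) = D(Hom_A(X,A))`: `(a • φ) f = φ (f · a)`. -/
instance (X : Type) [AddCommGroup X] [Module A X] : Module A (NuCarrier k A X) where
  smul a φ := φ.comp (rmulHom k A X a)
  one_smul φ := by
    refine LinearMap.ext fun f => ?_
    exact congrArg φ (by ext x; simp)
  mul_smul a b φ := by
    refine LinearMap.ext fun f => ?_
    exact congrArg φ (by ext x; simp [mul_assoc])
  smul_zero a := rfl
  smul_add a φ ψ := rfl
  add_smul a b φ := by
    refine LinearMap.ext fun f => ?_
    show φ ((rmulHom k A X (a + b)) f) = φ ((rmulHom k A X a) f) + φ ((rmulHom k A X b) f)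
    rw [show (rmulHom k A X (a + b)) f = (rmulHom k A X a) f + (rmulHom k A X b) f from by
      ext x; simp [mul_add]]
    exact map_add φ _ _
  zero_smul φ := by
    refine LinearMap.ext fun f => ?_
    show φ ((rmulHom k A X 0) f) = 0
    rw [show (rmulHom k A X 0) f = 0 from by ext x; simp]
    exact map_zero φ

/-- The Nakayama functor value `ν_A(X)` as an object of `ModuleCat A`. -/
noncomputable def NuMod (X : ModuleCat.{0} A) : ModuleCat.{0} A :=
  ModuleCat.of A (NuCarrier k A ↥X)

/-- `M` is Nakayama-stable: `add M = add (ν_A M)`. -/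
noncomputable def NakayamaStable (M : ModuleCat.{0} A) : Prop :=
  ∀ X : ModuleCat.{0} A, MemAdd A M X ↔ MemAdd A (NuMod k A M) X

end Nakayama

/-! ## Central scalars and finite-dimensionality of stable Homs -/

section Central

variable (k A : Type) [Field k] [Ring A] [Algebra k A]

/-- the `A`-linear endomorphism given by the action of the central element
`algebraMap k A c`. -/
def centralSmulLin (c : k) (X : Type) [AddCommGroup X] [Module A X] : X →ₗ[A] X where
  toFun x := algebraMap k A c • x
  map_add' x y := smul_add _ x y
  map_smul' a x := by
    simp only [RingHom.id_apply, smul_smul, Algebra.commutes]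

/-- `StHom_A(X, Y) = Hom_A(X,Y)/(morphisms factoring through projectives)` is
finite-dimensional over `k`: there are finitely many morphisms `f j` such that any
morphism agrees with a `k`-linear combination of the `f j` up to a morphism factoring
through a projective module. -/
def StHomProjFinDim (X Y : ModuleCat.{0} A) : Prop :=
  ∃ (m : ℕ) (f : Fin m → (X ⟶ Y)),
    ∀ g : X ⟶ Y, ∃ c : Fin m → k,
      FactorsThroughProj A (g - ∑ j, (ModuleCat.ofHom (centralSmulLin k A (c j) ↥X : ↥X →ₗ[A] ↥X) ≫ f j))

end Central

/-! ## Minimal injective coresolutions, cosyzygies, `M`-filtered modules -/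

section Cosyzygy

variable (A : Type) [Ring A]

/-- `ι : N ⟶ I` is an injective envelope: `I` is injective, `ι` is injective,
and the image of `ι` is an essential submodule of `I`. -/
def IsInjEnvelope {N I : ModuleCat.{0} A} (ι : N ⟶ I) : Prop :=
  Module.Injective A ↥I ∧ Function.Injective ι ∧
    ∀ K : Submodule A ↥I, K ⊓ LinearMap.range ι.hom = ⊥ → K = ⊥

/-- `C` is the sequence of cosyzygies of `M` along a minimal injective coresolution:
`C 0 ≅ M` and for each `n` there is a short exact sequence `0 → C n → I → C (n+1) → 0`
in which `C n → I` is an injective envelope. -/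
def IsMinInjCoresolution (M : ModuleCat.{0} A) (C : ℕ → ModuleCat.{0} A) : Prop :=
  Nonempty (C 0 ≅ M) ∧
    ∀ n, ∃ (I : ModuleCat.{0} A) (ι : C n ⟶ I) (p : I ⟶ C (n + 1)),
      IsInjEnvelope A ι ∧ Function.Surjective p ∧ LinearMap.range ι.hom = LinearMap.ker p.hom

/-- the family of modules `{A} ∪ {C i | i ∈ ℕ}`, indexed by `Option ℕ`. -/
def optPick (C : ℕ → ModuleCat.{0} A) : Option ℕ → ModuleCat.{0} A
  | none => ModuleCat.of A A
  | some i => C i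

/-- `Q` is isomorphic to a finite direct sum of modules from `{A} ∪ {C i | i ∈ ℕ}`. -/
def IsFinSumFrom (C : ℕ → ModuleCat.{0} A) (Q : Type) [AddCommGroup Q] [Module A Q] : Prop :=
  ∃ (m : ℕ) (T : Fin m → Option ℕ),
    Nonempty (Q ≃ₗ[A] ((j : Fin m) → ↥(optPick A C (T j))))

/-- `X` is `M`-filtered (where `C` encodes the cosyzygies `Ω_A^{-i}(M)`, `C 0 ≅ M`):
there is an ascending chain `0 = X₀ ⊆ X₁ ⊆ ⋯` of submodules with union `X` all of whose
subquotients are finite direct sums of modules from `{A} ∪ {Ω_A^{-i}(M) | i ∈ ℕ}`. -/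
def MFiltered (C : ℕ → ModuleCat.{0} A) (X : ModuleCat.{0} A) : Prop :=
  ∃ F : ℕ → Submodule A ↥X,
    Monotone F ∧ F 0 = ⊥ ∧ (⨆ n, F n) = ⊤ ∧
      ∀ n, IsFinSumFrom A C
        (↥(F (n + 1)) ⧸ (Submodule.comap (F (n + 1)).subtype (F n)))

/-- `X` is finitely `M`-filtered: as `MFiltered`, with a chain that reaches `⊤`
after finitely many steps. -/
def FinMFiltered (C : ℕ → ModuleCat.{0} A) (X : ModuleCat.{0} A) : Prop :=
  ∃ F : ℕ → Submodule A ↥X,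
    Monotone F ∧ F 0 = ⊥ ∧ (∃ n, F n = ⊤) ∧
      ∀ n, IsFinSumFrom A C
        (↥(F (n + 1)) ⧸ (Submodule.comap (F (n + 1)).subtype (F n)))

end Cosyzygy

/-! ## The class `𝒮` -/

section SClass

variable (A : Type) [Ring A]

/-- the closure properties defining the class `𝒮`: contains `M`, closed under
isomorphisms, direct summands, arbitrary direct sums, and satisfies two-out-of-three
for short exact sequences. -/
def IsSClosedClass (M : ModuleCat.{0} A) (P : ModuleCat.{0} A → Prop) : Prop :=
  P M ∧
  (∀ X Y : ModuleCat.{0} A, P X → Nonempty (X ≅ Y) → P Y) ∧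
  (∀ X Y : ModuleCat.{0} A, P Y → (∃ (i : X ⟶ Y) (r : Y ⟶ X), i ≫ r = 𝟙 X) → P X) ∧
  (∀ (I : Type) (Y : I → ModuleCat.{0} A), (∀ i, P (Y i)) → P (∐ Y)) ∧
  (∀ (X Y Z : ModuleCat.{0} A) (f : X ⟶ Y) (g : Y ⟶ Z),
    Function.Injective f → Function.Surjective g → LinearMap.range f.hom = LinearMap.ker g.hom →
      ((P X ∧ P Y → P Z) ∧ (P X ∧ P Z → P Y) ∧ (P Y ∧ P Z → P X)))

/-- `𝒮` is the smallest class containing `M`, closed under isomorphisms, direct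
summands and direct sums, with the two-out-of-three property. -/
def MemS (M X : ModuleCat.{0} A) : Prop :=
  ∀ P : ModuleCat.{0} A → Prop, IsSClosedClass A M P → P X

end SClass

/-! ## The class `ℰ` -/

section EClass

variable (k A : Type) [Field k] [Ring A] [Algebra k A]

/-- `X ∈ ℰ`: `X ∈ 𝒢` and the stable Homs `StHom_A(M,X)`, `StHom_A(Ω_A^{-1}(M),X)` are
finite-dimensional over `k`; here `Om1` stands for the first cosyzygy `Ω_A^{-1}(M)`. -/
noncomputable def MemE (M Om1 X : ModuleCat.{0} A) : Prop :=
  MemG A M X ∧ StHomProjFinDim k A M X ∧ StHomProjFinDim k A Om1 X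

end EClass

section ExtVanishing

variable {A : Type} [Ring A]

theorem extZero_succ_iff_subsingleton (n : ℕ) (X Y : ModuleCat.{0} A) :
    extZero A (n + 1) X Y ↔ Subsingleton (Abelian.Ext X Y (n + 1)) := by
  let P := ProjectiveResolution.of X
  have h1 : extZero A (n + 1) X Y ↔ ∀ f : P.complex.X (n + 1) ⟶ Y,
      P.complex.d (n + 2) (n + 1) ≫ f = 0 →
        ∃ g : P.complex.X n ⟶ Y, P.complex.d (n + 1) n ≫ g = f := by
    unfold extZero
    rw [← ModuleCat.isZero_iff_subsingleton, (P.isoExt (n + 1) Y).isZero_iff,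
      ← HomologicalComplex.exactAt_iff_isZero_homology,
      HomologicalComplex.exactAt_iff' _ n (n + 1) (n + 2) (by simp) (by simp),
      ShortComplex.moduleCat_exact_iff]
    rfl
  have h2 : Subsingleton (Abelian.Ext X Y (n + 1)) ↔ ∀ f : P.complex.X (n + 1) ⟶ Y,
      P.complex.d (n + 2) (n + 1) ≫ f = 0 →
        ∃ g : P.complex.X n ⟶ Y, P.complex.d (n + 1) n ≫ g = f := by
    constructor
    · intro h f hf
      exact (P.extMk_eq_zero_iff f (n + 2) rfl hf n rfl).1 (Subsingleton.elim _ _)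
    · intro h
      refine subsingleton_of_forall_eq 0 fun α => ?_
      obtain ⟨f, hf, rfl⟩ := P.extMk_surjective α (n + 2) rfl
      exact (P.extMk_eq_zero_iff f (n + 2) rfl hf n rfl).2 (h f hf)
  rw [h1, h2]

/-- The short complex attached to a pair of linear maps with `range f = ker g`. -/
@[simps] def shortComplexOfExact {X Y Z : ModuleCat.{0} A} (f : X →ₗ[A] Y) (g : Y →ₗ[A] Z)
    (h : LinearMap.range f = LinearMap.ker g) : ShortComplex (ModuleCat.{0} A) :=
  ShortComplex.mk (ModuleCat.ofHom f) (ModuleCat.ofHom g) (by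
    ext x
    have : f x ∈ LinearMap.ker g := h ▸ LinearMap.mem_range_self f x
    simpa using this)

theorem shortExact_shortComplexOfExact {X Y Z : ModuleCat.{0} A} {f : X →ₗ[A] Y}
    {g : Y →ₗ[A] Z} (hf : Function.Injective f) (hg : Function.Surjective g)
    (h : LinearMap.range f = LinearMap.ker g) : (shortComplexOfExact f g h).ShortExact where
  exact := by
    rw [ShortComplex.moduleCat_exact_iff_range_eq_ker]
    exact h
  mono_f := (ModuleCat.mono_iff_injective _).2 hf
  epi_g := (ModuleCat.epi_iff_surjective _).2 hg

theorem addEquiv₀_symm_comp_g_comp_extClass {S : ShortComplex (ModuleCat.{0} A)}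
    (hS : S.ShortExact) {N : ModuleCat.{0} A} (v : N ⟶ S.X₂) :
    (Abelian.Ext.addEquiv₀.symm (v ≫ S.g)).comp hS.extClass (zero_add 1) = 0 := by
  rw [Abelian.Ext.addEquiv₀_symm_apply, ← Abelian.Ext.mk₀_comp_mk₀,
    Abelian.Ext.comp_assoc_of_second_deg_zero, hS.comp_extClass, Abelian.Ext.comp_zero]

theorem extClass_comp_addEquiv₀_symm_f_comp {S : ShortComplex (ModuleCat.{0} A)}
    (hS : S.ShortExact) {N : ModuleCat.{0} A} (v : S.X₂ ⟶ N) :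
    hS.extClass.comp (Abelian.Ext.addEquiv₀.symm (S.f ≫ v)) (add_zero 1) = 0 := by
  rw [Abelian.Ext.addEquiv₀_symm_apply, ← Abelian.Ext.mk₀_comp_mk₀,
    ← Abelian.Ext.comp_assoc_of_second_deg_zero, hS.extClass_comp, Abelian.Ext.zero_comp]

theorem exists_comp_g_eq_of_subsingleton_ext_one {S : ShortComplex (ModuleCat.{0} A)}
    (hS : S.ShortExact) (N : ModuleCat.{0} A) (hX : Subsingleton (Abelian.Ext N S.X₁ 1))
    (u : N ⟶ S.X₃) : ∃ v : N ⟶ S.X₂, v ≫ S.g = u := by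
  obtain ⟨x, hx⟩ := Abelian.Ext.covariant_sequence_exact₃ (X := N) hS
    (Abelian.Ext.mk₀ u) (zero_add 1) (hX.elim _ _)
  obtain ⟨v, rfl⟩ := Abelian.Ext.addEquiv₀.symm.surjective x
  refine ⟨v, Abelian.Ext.addEquiv₀.symm.injective ?_⟩
  rw [Abelian.Ext.addEquiv₀_symm_apply, Abelian.Ext.addEquiv₀_symm_apply,
    ← Abelian.Ext.mk₀_comp_mk₀]
  exact hx

theorem exists_f_comp_eq_of_subsingleton_ext_one {S : ShortComplex (ModuleCat.{0} A)}
    (hS : S.ShortExact) (N : ModuleCat.{0} A) (hZ : Subsingleton (Abelian.Ext S.X₃ N 1))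
    (u : S.X₁ ⟶ N) : ∃ v : S.X₂ ⟶ N, S.f ≫ v = u := by
  obtain ⟨x, hx⟩ := Abelian.Ext.contravariant_sequence_exact₁ hS N
    (Abelian.Ext.mk₀ u) (n₁ := 1) (by omega) (hZ.elim _ _)
  obtain ⟨v, rfl⟩ := Abelian.Ext.addEquiv₀.symm.surjective x
  refine ⟨v, Abelian.Ext.addEquiv₀.symm.injective ?_⟩
  rw [Abelian.Ext.addEquiv₀_symm_apply, Abelian.Ext.addEquiv₀_symm_apply,
    ← Abelian.Ext.mk₀_comp_mk₀]
  exact hx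

section Sequences

variable {X Y Z : ModuleCat.{0} A} {f : X →ₗ[A] Y} {g : Y →ₗ[A] Z}
theorem subsingleton_ext_middle
    (hf : Function.Injective f) (hg : Function.Surjective g)
    (h : LinearMap.range f = LinearMap.ker g)
    (N : ModuleCat.{0} A) (n : ℕ)
    (hX : Subsingleton (Abelian.Ext N X n)) (hZ : Subsingleton (Abelian.Ext N Z n)) :
    Subsingleton (Abelian.Ext N Y n) := by
  have hS := shortExact_shortComplexOfExact hf hg h
  refine subsingleton_of_forall_eq 0 fun y => ?_
  obtain ⟨x, rfl⟩ := Abelian.Ext.covariant_sequence_exact₂ (X := N) hS y (hZ.elim _ _)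
  rw [hX.elim x 0]
  exact Abelian.Ext.zero_comp ..

theorem subsingleton_ext_succ_left_iff_of_injective
    (hf : Function.Injective f) (hg : Function.Surjective g)
    (h : LinearMap.range f = LinearMap.ker g)
    (N : ModuleCat.{0} A)
    (hY : Module.Injective A Y) (n : ℕ) :
    Subsingleton (Abelian.Ext N Z (n + 1)) ↔ Subsingleton (Abelian.Ext N X (n + 2)) := by
  have hS := shortExact_shortComplexOfExact hf hg h
  have hI : CategoryTheory.Injective Y := Module.injective_object_of_injective_module A Y
  constructor
  · intro hZ
    refine subsingleton_of_forall_eq 0 fun y => ?_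
    obtain ⟨x, rfl⟩ := Abelian.Ext.covariant_sequence_exact₁ (X := N) hS y
      (Abelian.Ext.eq_zero_of_injective (I := Y) _) rfl
    rw [hZ.elim x 0]
    exact Abelian.Ext.zero_comp ..
  · intro hX
    refine subsingleton_of_forall_eq 0 fun y => ?_
    obtain ⟨x, rfl⟩ := Abelian.Ext.covariant_sequence_exact₃ (X := N) hS y rfl (hX.elim _ _)
    rw [Abelian.Ext.eq_zero_of_injective (I := Y) x]
    exact Abelian.Ext.zero_comp ..

theorem subsingleton_ext_one_of_lift
    (hf : Function.Injective f) (hg : Function.Surjective g)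
    (h : LinearMap.range f = LinearMap.ker g)
    (N : ModuleCat.{0} A)
    (hY : Module.Injective A Y) (hlift : ∀ u : N →ₗ[A] Z, ∃ v : N →ₗ[A] Y, g ∘ₗ v = u) :
    Subsingleton (Abelian.Ext N X 1) := by
  have hS := shortExact_shortComplexOfExact hf hg h
  have hI : CategoryTheory.Injective Y := Module.injective_object_of_injective_module A Y
  refine subsingleton_of_forall_eq 0 fun y => ?_
  obtain ⟨x, rfl⟩ := Abelian.Ext.covariant_sequence_exact₁ (X := N) hS y
    (Abelian.Ext.eq_zero_of_injective (I := Y) _) (zero_add 1)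
  obtain ⟨u, rfl⟩ := Abelian.Ext.addEquiv₀.symm.surjective x
  obtain ⟨v, hv⟩ := hlift u.hom
  have : u = ModuleCat.ofHom v ≫ (shortComplexOfExact f g h).g := by
    ext x
    exact (LinearMap.congr_fun hv x).symm
  rw [this]
  exact addEquiv₀_symm_comp_g_comp_extClass hS (ModuleCat.ofHom v)

theorem exists_lift_of_subsingleton_ext_one
    (hf : Function.Injective f) (hg : Function.Surjective g)
    (h : LinearMap.range f = LinearMap.ker g)
    (N : ModuleCat.{0} A)
    (hX : Subsingleton (Abelian.Ext N X 1)) (u : N →ₗ[A] Z) : ∃ v : N →ₗ[A] Y, g ∘ₗ v = u := by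
  obtain ⟨v, hv⟩ := exists_comp_g_eq_of_subsingleton_ext_one
    (shortExact_shortComplexOfExact hf hg h) N hX (ModuleCat.ofHom u)
  exact ⟨v.hom, congrArg ModuleCat.Hom.hom hv⟩

theorem subsingleton_ext_succ_right_iff_of_projective
    (hf : Function.Injective f) (hg : Function.Surjective g)
    (h : LinearMap.range f = LinearMap.ker g)
    (N : ModuleCat.{0} A)
    (hY : Module.Projective A Y) (n : ℕ) :
    Subsingleton (Abelian.Ext X N (n + 1)) ↔ Subsingleton (Abelian.Ext Z N (n + 2)) := by
  have hS := shortExact_shortComplexOfExact hf hg h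
  have hP : CategoryTheory.Projective Y := (IsProjective.iff_projective Y).1 hY
  constructor
  · intro hX
    refine subsingleton_of_forall_eq 0 fun y => ?_
    obtain ⟨x, rfl⟩ := Abelian.Ext.contravariant_sequence_exact₃ hS N y
      (Abelian.Ext.eq_zero_of_projective (P := Y) _) (n₀ := n + 1) (by omega)
    rw [hX.elim x 0]
    exact Abelian.Ext.comp_zero ..
  · intro hZ
    refine subsingleton_of_forall_eq 0 fun y => ?_
    obtain ⟨x, rfl⟩ := Abelian.Ext.contravariant_sequence_exact₁ hS N y (n₁ := n + 2) (by omega)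
      (hZ.elim _ _)
    rw [Abelian.Ext.eq_zero_of_projective (P := Y) x]
    exact Abelian.Ext.comp_zero ..

theorem subsingleton_ext_one_of_extend
    (hf : Function.Injective f) (hg : Function.Surjective g)
    (h : LinearMap.range f = LinearMap.ker g)
    (N : ModuleCat.{0} A)
    (hY : Module.Projective A Y) (hext : ∀ u : X →ₗ[A] N, ∃ v : Y →ₗ[A] N, v ∘ₗ f = u) :
    Subsingleton (Abelian.Ext Z N 1) := by
  have hS := shortExact_shortComplexOfExact hf hg h
  have hP : CategoryTheory.Projective Y := (IsProjective.iff_projective Y).1 hY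
  refine subsingleton_of_forall_eq 0 fun y => ?_
  obtain ⟨x, rfl⟩ := Abelian.Ext.contravariant_sequence_exact₃ hS N y
    (Abelian.Ext.eq_zero_of_projective (P := Y) _) (n₀ := 0) (by omega)
  obtain ⟨u, rfl⟩ := Abelian.Ext.addEquiv₀.symm.surjective x
  obtain ⟨v, hv⟩ := hext u.hom
  have : u = (shortComplexOfExact f g h).f ≫ ModuleCat.ofHom v := by
    ext x
    exact (LinearMap.congr_fun hv x).symm
  rw [this]
  exact extClass_comp_addEquiv₀_symm_f_comp hS (ModuleCat.ofHom v)

theorem exists_extend_of_subsingleton_ext_one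
    (hf : Function.Injective f) (hg : Function.Surjective g)
    (h : LinearMap.range f = LinearMap.ker g)
    (N : ModuleCat.{0} A)
    (hZ : Subsingleton (Abelian.Ext Z N 1)) (u : X →ₗ[A] N) : ∃ v : Y →ₗ[A] N, v ∘ₗ f = u := by
  obtain ⟨v, hv⟩ := exists_f_comp_eq_of_subsingleton_ext_one
    (shortExact_shortComplexOfExact hf hg h) N hZ (ModuleCat.ofHom u)
  exact ⟨v.hom, congrArg ModuleCat.Hom.hom hv⟩

end Sequences

/-- Vanishing of `Ext^n(N, -)` passes to a module whose finitely generated submodules are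
contained in submodules on which it vanishes, provided `N` is finitely generated. -/
theorem subsingleton_ext_of_locally [IsNoetherianRing A] (n : ℕ) (N X : ModuleCat.{0} A)
    [Module.Finite A N]
    (hloc : ∀ K : Submodule A X, K.FG → ∃ (W : ModuleCat.{0} A) (j : W →ₗ[A] X),
      Function.Injective j ∧ K ≤ LinearMap.range j ∧ Subsingleton (Abelian.Ext N W (n + 1))) :
    Subsingleton (Abelian.Ext N X (n + 1)) := by
  induction n generalizing N with
  | zero =>
    obtain ⟨r, q, hq⟩ := Module.Finite.exists_fin' A N
    refine subsingleton_ext_one_of_extend (X := ModuleCat.of A (LinearMap.ker q))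
      (Y := ModuleCat.of A (Fin r → A)) (Z := N) (f := (LinearMap.ker q).subtype) (g := q)
      (Submodule.injective_subtype _) hq (by simp) X
      (inferInstanceAs (Module.Projective A (Fin r → A))) fun u => ?_
    have hfin : (LinearMap.range u).FG := by
      have : Module.Finite A (LinearMap.ker q) := inferInstance
      exact (Submodule.fg_top _).1 (Module.Finite.fg_top (R := A) (M := LinearMap.range u))
    obtain ⟨W, j, hj, hle, hW⟩ := hloc _ hfin
    let e := LinearEquiv.ofInjective j hj
    let u' : LinearMap.ker q →ₗ[A] W :=
      e.symm.toLinearMap ∘ₗ u.codRestrict (LinearMap.range j) fun x => hle ⟨x, rfl⟩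
    have hu' : j ∘ₗ u' = u := by
      ext x
      exact congrArg Subtype.val (e.apply_symm_apply _)
    obtain ⟨v, hv⟩ := exists_extend_of_subsingleton_ext_one
      (X := ModuleCat.of A (LinearMap.ker q))
      (Y := ModuleCat.of A (Fin r → A)) (Z := N) (f := (LinearMap.ker q).subtype) (g := q)
      (Submodule.injective_subtype _) hq (by simp) W hW u'
    exact ⟨j ∘ₗ v, by rw [LinearMap.comp_assoc, hv, hu']⟩
  | succ n ih =>
    obtain ⟨r, q, hq⟩ := Module.Finite.exists_fin' A N
    have key (W : ModuleCat.{0} A) := subsingleton_ext_succ_right_iff_of_projective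
      (X := ModuleCat.of A (LinearMap.ker q))
      (Y := ModuleCat.of A (Fin r → A)) (Z := N) (f := (LinearMap.ker q).subtype) (g := q)
      (Submodule.injective_subtype _) hq (by simp) W
      (inferInstanceAs (Module.Projective A (Fin r → A))) n
    have : Module.Finite A (ModuleCat.of A (LinearMap.ker q)) :=
      inferInstanceAs (Module.Finite A (LinearMap.ker q))
    rw [← key]
    refine ih _ fun K hK => ?_
    obtain ⟨W, j, hj, hle, hW⟩ := hloc K hK
    exact ⟨W, j, hj, hle, (key W).2 hW⟩

/-- Vanishing of `Ext^n(X, -)` passes along finite families of maps decomposing the identity. -/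
theorem subsingleton_ext_of_sum_comp_eq_id {X N M : ModuleCat.{0} A} {r : ℕ} (n : ℕ)
    (a : Fin r → (M ⟶ N)) (b : Fin r → (N ⟶ M)) (hab : ∑ i, a i ≫ b i = 𝟙 M)
    (hN : Subsingleton (Abelian.Ext X N n)) : Subsingleton (Abelian.Ext X M n) := by
  refine subsingleton_of_forall_eq 0 fun y => ?_
  have h1 : y = y.comp (Abelian.Ext.mk₀ (∑ i, a i ≫ b i)) (add_zero n) := by
    rw [hab, Abelian.Ext.comp_mk₀_id]
  rw [h1, Abelian.Ext.mk₀_sum, Abelian.Ext.comp_sum]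
  refine Finset.sum_eq_zero fun i _ => ?_
  rw [← Abelian.Ext.mk₀_comp_mk₀, ← Abelian.Ext.comp_assoc_of_second_deg_zero,
    hN.elim (y.comp (Abelian.Ext.mk₀ (a i)) (add_zero n)) 0, Abelian.Ext.zero_comp]

end ExtVanishing

section QuasiFrobenius

variable {A : Type} [Ring A]

/-- In an artinian module, the common kernel of a family of linear maps is the common kernel
of a finite subfamily. -/
theorem exists_fin_forall_eq_zero {N ι : Type} {Y : ι → Type} [AddCommGroup N] [Module A N]
    [IsArtinian A N] [∀ i, AddCommGroup (Y i)] [∀ i, Module A (Y i)]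
    (φ : ∀ i, N →ₗ[A] Y i) :
    ∃ (n : ℕ) (s : Fin n → ι), ∀ x, (∀ j, φ (s j) x = 0) → ∀ i, φ i x = 0 := by
  classical
  obtain ⟨_, ⟨s, rfl⟩, hs⟩ := IsArtinian.set_has_minimal
    (Set.range fun s : Finset ι => ⨅ i ∈ s, LinearMap.ker (φ i)) (Set.range_nonempty _)
  refine ⟨s.card, fun j => (s.equivFin.symm j : ι), fun x hx i => ?_⟩
  have hx' : x ∈ ⨅ i ∈ s, LinearMap.ker (φ i) := by
    simp only [Submodule.mem_iInf]
    intro i hi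
    have := hx (s.equivFin ⟨i, hi⟩)
    beta_reduce at this
    rwa [Equiv.symm_apply_apply] at this
  have hle : (⨅ j ∈ insert i s, LinearMap.ker (φ j)) ≤ ⨅ j ∈ s, LinearMap.ker (φ j) :=
    biInf_mono fun j hj => Finset.mem_insert_of_mem hj
  have heq := eq_of_le_of_not_lt hle (hs _ (Set.mem_range_self (insert i s)))
  rw [← heq] at hx'
  simp only [Submodule.mem_iInf] at hx'
  exact hx' i (Finset.mem_insert_self i s)

theorem nonempty_linearEquiv_of_annihilator_le [IsArtinianRing A] {S T : Type}
    [AddCommGroup S] [Module A S] [AddCommGroup T] [Module A T]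
    [IsSimpleModule A S] [IsSimpleModule A T]
    (h : Module.annihilator A S ≤ Module.annihilator A T) : Nonempty (S ≃ₗ[A] T) := by
  classical
  obtain ⟨n, s, hs⟩ := exists_fin_forall_eq_zero (fun x : S => LinearMap.toSpanSingleton A S x)
  let φ : A →ₗ[A] Fin n → S := LinearMap.pi fun j => LinearMap.toSpanSingleton A S (s j)
  have : Nontrivial T := IsSimpleModule.nontrivial A T
  obtain ⟨x, hx⟩ := exists_ne (0 : T)
  let ψ : A →ₗ[A] T := LinearMap.toSpanSingleton A T x
  have hker : LinearMap.ker φ ≤ LinearMap.ker ψ := by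
    intro a ha
    have h1 := hs a fun j => congrFun ha j
    have h2 : a ∈ Module.annihilator A T := h (Module.mem_annihilator.2 h1)
    exact Module.mem_annihilator.1 h2 x
  obtain ⟨g, hg⟩ := IsSemisimpleModule.extension_property
    ((LinearMap.ker φ).liftQ φ le_rfl)
    (LinearMap.ker_eq_bot.1 (Submodule.ker_liftQ_eq_bot _ _ _ le_rfl))
    ((LinearMap.ker φ).liftQ ψ hker)
  have hg1 : g (φ 1) = x := by
    have := LinearMap.congr_fun hg ((LinearMap.ker φ).mkQ 1)
    simpa [ψ] using this
  have hg0 : g ≠ 0 := by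
    rintro rfl
    exact hx (by simpa using hg1.symm)
  obtain ⟨i, hi⟩ : ∃ i, g ∘ₗ LinearMap.single A (fun _ => S) i ≠ 0 := by
    by_contra! hcon
    exact hg0 (LinearMap.pi_ext' fun i => by simpa using hcon i)
  exact ⟨LinearEquiv.ofBijective _ (LinearMap.bijective_of_ne_zero hi)⟩

/-- A proper two-sided ideal that is maximal among proper two-sided ideals. -/
def IsMaximalTwoSided (I : Ideal A) : Prop :=
  I.IsTwoSided ∧ I ≠ ⊤ ∧ ∀ J : Ideal A, J.IsTwoSided → I ≤ J → J ≠ ⊤ → J = I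

theorem isMaximalTwoSided_annihilator [IsArtinianRing A] (S : Type) [AddCommGroup S]
    [Module A S] [IsSimpleModule A S] : IsMaximalTwoSided (Module.annihilator A S) := by
  refine ⟨inferInstance, ?_, fun J hJ hle hne => ?_⟩
  · intro h
    have : Nontrivial S := IsSimpleModule.nontrivial A S
    obtain ⟨x, hx⟩ := exists_ne (0 : S)
    have h1 : (1 : A) ∈ Module.annihilator A S := h ▸ Submodule.mem_top
    exact hx (by simpa using Module.mem_annihilator.1 h1 x)
  · obtain ⟨m, hm, hJm⟩ := Ideal.exists_le_maximal J hne
    have : IsSimpleModule A (A ⧸ m) := isSimpleModule_iff_quot_maximal.2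
      ⟨m, hm, ⟨LinearEquiv.refl _ _⟩⟩
    have hJ' : J ≤ Module.annihilator A (A ⧸ m) := by
      intro a ha
      rw [Module.mem_annihilator]
      intro x
      obtain ⟨y, rfl⟩ := Submodule.mkQ_surjective _ x
      rw [← map_smul, Submodule.mkQ_apply, Submodule.Quotient.mk_eq_zero]
      exact hJm (hJ.mul_mem_of_left y ha)
    obtain ⟨e⟩ := nonempty_linearEquiv_of_annihilator_le (S := S) (hle.trans hJ')
    exact le_antisymm (e.annihilator_eq ▸ hJ') hle

theorem IsMaximalTwoSided.exists_add_eq_one {I J : Ideal A} (hI : IsMaximalTwoSided I)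
    (hJ : IsMaximalTwoSided J) (hne : I ≠ J) : ∃ x ∈ I, ∃ y ∈ J, x + y = 1 := by
  have hIJ : I ⊔ J = ⊤ := by
    by_contra h
    have h2 : (I ⊔ J).IsTwoSided := ⟨fun b ha => by
      obtain ⟨x, hx, y, hy, rfl⟩ := Submodule.mem_sup.1 ha
      rw [add_mul]
      exact add_mem (Ideal.mem_sup_left (hI.1.mul_mem_of_left b hx))
        (Ideal.mem_sup_right (hJ.1.mul_mem_of_left b hy))⟩
    exact hne ((hI.2.2 _ h2 le_sup_left h).symm.trans (hJ.2.2 _ h2 le_sup_right h))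
  exact Submodule.mem_sup.1 (hIJ ▸ Submodule.mem_top)

theorem IsMaximalTwoSided.exists_fin_add_eq_one {I : Ideal A} (hI : IsMaximalTwoSided I)
    {n : ℕ} (J : Fin n → Ideal A) (hJ : ∀ j, IsMaximalTwoSided (J j)) (hne : ∀ j, J j ≠ I) :
    ∃ x, (∀ j, x ∈ J j) ∧ ∃ y ∈ I, x + y = 1 := by
  induction n with
  | zero => exact ⟨1, fun j => j.elim0, 0, I.zero_mem, add_zero 1⟩
  | succ n ih =>
    obtain ⟨x, hx, y, hy, hxy⟩ := ih (fun j => J j.succ) (fun j => hJ _) fun j => hne _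
    obtain ⟨x', hx', y', hy', hxy'⟩ := (hJ 0).exists_add_eq_one hI (hne 0)
    refine ⟨x' * x, fun j => ?_, x' * y + y' * (x + y), ?_, ?_⟩
    · refine Fin.cases ?_ (fun j => ?_) j
      · exact (hJ 0).1.mul_mem_of_left _ hx'
      · exact Ideal.mul_mem_left _ _ (hx j)
    · exact add_mem (Ideal.mul_mem_left _ _ hy) (hI.1.mul_mem_of_left _ hy')
    · rw [← add_assoc, ← mul_add, ← add_mul, hxy, hxy', one_mul]

theorem finite_isMaximalTwoSided [IsArtinianRing A] :
    Finite {I : Ideal A // IsMaximalTwoSided I} := by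
  obtain ⟨n, s, hs⟩ := exists_fin_forall_eq_zero
    (fun I : {I : Ideal A // IsMaximalTwoSided I} => (I : Ideal A).mkQ)
  refine Finite.of_surjective s fun I => ?_
  by_contra! hne
  obtain ⟨x, hx, y, hy, hxy⟩ := I.2.exists_fin_add_eq_one (fun j => (s j : Ideal A))
    (fun j => (s j).2) fun j h => hne j (Subtype.ext h)
  have hxI : x ∈ (I : Ideal A) := by
    have := hs x (fun j => by simpa using hx j) I
    simpa using this
  exact I.2.2.1 ((Ideal.eq_top_iff_one _).2 (hxy ▸ add_mem hxI hy))

/-- Over a left artinian left self-injective ring, every proper two-sided ideal annihilates a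
minimal left ideal from the right. -/
theorem exists_isSimpleModule_forall_mul_eq_zero [IsArtinianRing A] [Module.Injective A A]
    {I : Ideal A} (hI : I.IsTwoSided) (hne : I ≠ ⊤) :
    ∃ P : Ideal A, IsSimpleModule A P ∧ ∀ a ∈ P, ∀ x ∈ I, a * x = 0 := by
  let L : Ideal A := ⨅ x : I, LinearMap.ker (LinearMap.toSpanSingleton A A (x : A))
  have hL : L ≠ ⊥ := by
    intro hbot
    obtain ⟨n, s, hs⟩ := exists_fin_forall_eq_zero
      (fun x : I => LinearMap.toSpanSingleton A A (x : A))
    let φ : A →ₗ[A] Fin n → A := LinearMap.pi fun j => LinearMap.toSpanSingleton A A (s j : A)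
    have hφ : Function.Injective φ := by
      refine (injective_iff_map_eq_zero _).2 fun a ha => ?_
      have : a ∈ L := by
        simp only [L, Submodule.mem_iInf]
        exact hs a fun j => congrFun ha j
      simpa [hbot] using this
    obtain ⟨h, hh⟩ := Module.Injective.out φ hφ LinearMap.id
    refine hne ((Ideal.eq_top_iff_one _).2 ?_)
    have h1 : h (φ 1) = 1 := hh 1
    rw [← h1, LinearMap.pi_apply_eq_sum_univ]
    refine sum_mem fun j _ => ?_
    exact hI.mul_mem_of_left _ (Ideal.mul_mem_left _ 1 (s j).2)
  obtain ⟨P, hP, hPL⟩ := (eq_bot_or_exists_atom_le L).resolve_left hL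
  refine ⟨P, isSimpleModule_iff_isAtom.2 hP, fun a ha x hx => ?_⟩
  have h1 := hPL ha
  simp only [L, Submodule.mem_iInf] at h1
  exact h1 ⟨x, hx⟩

theorem exists_injective_of_isSimpleModule [IsArtinianRing A] [Module.Injective A A]
    (S : Type) [AddCommGroup S] [Module A S] [IsSimpleModule A S] :
    ∃ f : S →ₗ[A] A, Function.Injective f := by
  choose P hP hPI using fun I : {I : Ideal A // IsMaximalTwoSided I} =>
    exists_isSimpleModule_forall_mul_eq_zero I.2.1 I.2.2.1
  let g : {I : Ideal A // IsMaximalTwoSided I} → {I : Ideal A // IsMaximalTwoSided I} :=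
    fun I => ⟨Module.annihilator A (P I), isMaximalTwoSided_annihilator (P I)⟩
  have hg : Function.Injective g := by
    intro I J hIJ
    by_contra hne
    obtain ⟨e⟩ := nonempty_linearEquiv_of_annihilator_le (S := P I) (T := P J)
      (congrArg Subtype.val hIJ).le
    obtain ⟨h, hh⟩ := Module.Injective.out (P I).subtype (Submodule.injective_subtype _)
      ((P J).subtype ∘ₗ e.toLinearMap)
    have : Nontrivial (P I) := IsSimpleModule.nontrivial A _
    obtain ⟨a, ha⟩ := exists_ne (0 : P I)
    obtain ⟨x, hx, y, hy, hxy⟩ := I.2.exists_add_eq_one J.2 fun h => hne (Subtype.ext h)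
    have h1 : (a : A) * h 1 = e a := by
      rw [← smul_eq_mul, ← map_smul, smul_eq_mul, mul_one]
      exact hh a
    have h2 : (e a : A) = 0 := by
      rw [← mul_one (e a : A), ← hxy, mul_add, hPI J _ (e a).2 y hy, add_zero, ← h1, mul_assoc]
      exact hPI I _ a.2 _ (Ideal.mul_mem_left _ _ hx)
    exact ha (e.map_eq_zero_iff.1 (Subtype.ext h2))
  have := finite_isMaximalTwoSided (A := A)
  obtain ⟨I, hI⟩ := Finite.injective_iff_surjective.1 hg
    ⟨Module.annihilator A S, isMaximalTwoSided_annihilator S⟩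
  obtain ⟨e⟩ := nonempty_linearEquiv_of_annihilator_le (S := S) (T := P I)
    (congrArg Subtype.val hI).ge
  exact ⟨(P I).subtype ∘ₗ e.toLinearMap, (Submodule.injective_subtype _).comp e.injective⟩

theorem exists_injective_fin [IsArtinianRing A] [Module.Injective A A]
    (N : Type) [AddCommGroup N] [Module A N] [IsArtinian A N] :
    ∃ (n : ℕ) (f : N →ₗ[A] (Fin n → A)), Function.Injective f := by
  obtain ⟨n, s, hs⟩ := exists_fin_forall_eq_zero (fun f : N →ₗ[A] A => f)
  refine ⟨n, LinearMap.pi s, (injective_iff_map_eq_zero _).2 fun x hx => ?_⟩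
  by_contra hne
  have hx' := hs x fun j => congrFun hx j
  obtain ⟨S, hS, hSx⟩ := (eq_bot_or_exists_atom_le (Submodule.span A {x})).resolve_left
    (by simpa using hne)
  have := isSimpleModule_iff_isAtom.2 hS
  obtain ⟨f, hf⟩ := exists_injective_of_isSimpleModule (A := A) S
  obtain ⟨h, hh⟩ : ∃ h : N →ₗ[A] A, ∀ y : S, h y = f y :=
    Module.Injective.out S.subtype (Submodule.injective_subtype _) f
  have : Nontrivial S := IsSimpleModule.nontrivial A _
  obtain ⟨a, ha⟩ := exists_ne (0 : S)
  obtain ⟨c, hc⟩ := Submodule.mem_span_singleton.1 (hSx a.2)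
  apply ha
  apply hf
  rw [← hh a, ← hc, map_smul, hx', smul_zero, map_zero]

end QuasiFrobenius

section ProjectiveInjective

variable {A : Type} [Ring A]
variable {N X Y Z : Type} [AddCommGroup N] [Module A N] [AddCommGroup X] [Module A X]
  [AddCommGroup Y] [Module A Y] [AddCommGroup Z] [Module A Z]

/-- A linear map out of a finitely generated module meets only finitely many components of a
locally finite family of coordinate maps. -/
theorem finite_setOf_comp_ne_zero [Module.Finite A N] {ι : Type} {W : ι → Type}
    [∀ i, AddCommGroup (W i)] [∀ i, Module A (W i)] (p : ∀ i, Y →ₗ[A] W i)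
    (hp : ∀ y, {i | p i y ≠ 0}.Finite) (f : N →ₗ[A] Y) : {i | p i ∘ₗ f ≠ 0}.Finite := by
  obtain ⟨s, hs⟩ := Module.Finite.fg_top (R := A) (M := N)
  refine (s.finite_toSet.biUnion fun x _ => hp (f x)).subset fun i hi => ?_
  by_contra hcon
  simp only [Set.mem_iUnion, Set.mem_ofPred_eq, not_exists, not_not] at hcon
  exact hi (LinearMap.ext_on hs fun x hx => by simpa using hcon x hx)

/-- A linear map out of a finitely generated module into a direct sum is the finite sum of its
components. -/
theorem exists_eq_sum_comp [Module.Finite A N] {ι : Type} {W : ι → Type}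
    [∀ i, AddCommGroup (W i)] [∀ i, Module A (W i)] (p : ∀ i, Y →ₗ[A] W i)
    (e : ∀ i, W i →ₗ[A] Y) (hp : ∀ y, {i | p i y ≠ 0}.Finite)
    (hp0 : ∀ y, (∀ i, p i y = 0) → y = 0) (hpe : ∀ i w, p i (e i w) = w)
    (hpe0 : ∀ i j w, i ≠ j → p i (e j w) = 0) (f : N →ₗ[A] Y) :
    ∃ s : Finset ι, f = ∑ i ∈ s, e i ∘ₗ p i ∘ₗ f := by
  classical
  have hfin := finite_setOf_comp_ne_zero p hp f
  refine ⟨hfin.toFinset, LinearMap.ext fun x => sub_eq_zero.1 (hp0 _ fun i => ?_)⟩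
  simp only [map_sub, LinearMap.sum_apply, map_sum, LinearMap.comp_apply]
  by_cases hi : i ∈ hfin.toFinset
  · rw [Finset.sum_eq_single_of_mem i hi fun j _ hj => hpe0 i j _ hj.symm, hpe, sub_self]
  · rw [Finset.sum_eq_zero fun j hj => hpe0 i j _ fun h => hi (h ▸ hj), sub_zero]
    have : p i ∘ₗ f = 0 := by simpa using hi
    exact LinearMap.congr_fun this x

theorem exists_eq_sum_finsupp [Module.Finite A N] {ι : Type} (f : N →ₗ[A] (ι →₀ Y)) :
    ∃ s : Finset ι, f = ∑ i ∈ s, Finsupp.lsingle i ∘ₗ Finsupp.lapply i ∘ₗ f :=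
  exists_eq_sum_comp (fun i => Finsupp.lapply i) (fun i => Finsupp.lsingle i)
    (fun y => y.support.finite_toSet.subset fun i hi => by simpa using hi)
    (fun y hy => Finsupp.ext hy) (fun i w => by simp) (fun i j w h => by simp [h]) f

theorem exists_eq_sum_directSum [Module.Finite A N] {ι : Type} [DecidableEq ι] {W : ι → Type}
    [∀ i, AddCommGroup (W i)] [∀ i, Module A (W i)] (f : N →ₗ[A] DirectSum ι W) :
    ∃ s : Finset ι, f =
      ∑ i ∈ s, DirectSum.lof A ι W i ∘ₗ DirectSum.component A ι W i ∘ₗ f := by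
  classical
  exact exists_eq_sum_comp (fun i => DirectSum.component A ι W i) (fun i => DirectSum.lof A ι W i)
    (fun y => (DFinsupp.support y).finite_toSet.subset fun i hi =>
      Finset.mem_coe.2 (DFinsupp.mem_support_toFun y i |>.2 hi))
    (fun y hy => DFinsupp.ext hy) (fun i w => DirectSum.component.lof_self A i w)
    (fun i j w h => by rw [DirectSum.component.of, dif_neg h.symm]) f

theorem injective_finsupp_self [IsNoetherianRing A] [Module.Injective A A] (ι : Type) :
    Module.Injective A (ι →₀ A) := by
  refine Module.Baer.injective fun I g => ?_
  obtain ⟨s, hs⟩ := exists_eq_sum_finsupp g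
  choose h hh using fun i => Module.Injective.out I.subtype (Submodule.injective_subtype _)
    (Finsupp.lapply (R := A) (M := A) i ∘ₗ g)
  refine ⟨∑ i ∈ s, Finsupp.lsingle i ∘ₗ h i, fun x hx => ?_⟩
  rw [hs, LinearMap.sum_apply, LinearMap.sum_apply]
  exact Finset.sum_congr rfl fun i _ =>
    congrArg (Finsupp.lsingle (R := A) i) (hh i ⟨x, hx⟩)

theorem Module.Injective.of_retract [Module.Injective A Y] (i : X →ₗ[A] Y) (r : Y →ₗ[A] X)
    (h : r ∘ₗ i = LinearMap.id) : Module.Injective A X where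
  out P Q _ _ _ _ f hf g := by
    obtain ⟨u, hu⟩ := Module.Injective.out f hf (i ∘ₗ g)
    refine ⟨r ∘ₗ u, fun x => ?_⟩
    rw [LinearMap.comp_apply, hu]
    exact LinearMap.congr_fun h (g x)

theorem injective_of_projective [IsNoetherianRing A] [Module.Injective A A]
    [Module.Projective A X] : Module.Injective A X := by
  obtain ⟨s, hs⟩ := Module.projective_def'.1 (inferInstance : Module.Projective A X)
  have := injective_finsupp_self (A := A) X
  exact Module.Injective.of_retract _ _ hs

/-- An essential extension of a finitely generated module by an injective module over a
quasi-Frobenius ring is finitely generated and projective. -/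
theorem finite_projective_of_isInjEnvelope [IsArtinianRing A] [Module.Injective A A]
    {N I : ModuleCat.{0} A} [Module.Finite A N] {ι : N ⟶ I} (h : IsInjEnvelope A ι) :
    Module.Finite A I ∧ Module.Projective A I := by
  obtain ⟨hI, hι, hess⟩ := h
  obtain ⟨n, f, hf⟩ := exists_injective_fin (A := A) N
  obtain ⟨u, hu⟩ := Module.Injective.out ι.hom hι f
  have hker : LinearMap.ker u = ⊥ := by
    apply hess
    rw [eq_bot_iff]
    rintro _ ⟨hx, ⟨y, rfl⟩⟩
    have : f y = 0 := (hu y).symm.trans hx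
    have hy : y = 0 := hf (this.trans (map_zero f).symm)
    simp [hy]
  obtain ⟨r, hr⟩ := Module.Injective.out u (LinearMap.ker_eq_bot.1 hker) LinearMap.id
  exact ⟨Module.Finite.of_surjective r fun x => ⟨u x, hr x⟩,
    Module.Projective.of_split u r (LinearMap.ext hr)⟩

/-- A linear map factors through a free module. -/
def FactorsFree (f : X →ₗ[A] Y) : Prop :=
  ∃ (ι : Type) (g : X →ₗ[A] (ι →₀ A)) (h : (ι →₀ A) →ₗ[A] Y), h ∘ₗ g = f

theorem factorsFree_comp_of_projective [Module.Projective A Y] (g : X →ₗ[A] Y) (h : Y →ₗ[A] Z) :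
    FactorsFree (h ∘ₗ g) := by
  obtain ⟨s, hs⟩ := Module.projective_def'.1 (inferInstance : Module.Projective A Y)
  refine ⟨Y, s ∘ₗ g, h ∘ₗ Finsupp.linearCombination A id, ?_⟩
  rw [LinearMap.comp_assoc, ← LinearMap.comp_assoc g, hs, LinearMap.id_comp]

theorem factorsThroughProj_iff {X Y : ModuleCat.{0} A} (f : X ⟶ Y) :
    FactorsThroughProj A f ↔ FactorsFree f.hom := by
  constructor
  · rintro ⟨P, hP, g, h, rfl⟩
    exact factorsFree_comp_of_projective g.hom h.hom
  · rintro ⟨ι, g, h, hgh⟩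
    refine ⟨ModuleCat.of A (ι →₀ A), inferInstanceAs (Module.Projective A (ι →₀ A)),
      ModuleCat.ofHom g, ModuleCat.ofHom h, ?_⟩
    ext x
    exact (LinearMap.congr_fun hgh x).symm

theorem FactorsFree.comp_left {f : X →ₗ[A] Y} (hf : FactorsFree f) (u : Y →ₗ[A] Z) :
    FactorsFree (u ∘ₗ f) := by
  obtain ⟨ι, g, h, rfl⟩ := hf
  exact ⟨ι, g, u ∘ₗ h, rfl⟩

theorem FactorsFree.zero : FactorsFree (0 : X →ₗ[A] Y) := ⟨Empty, 0, 0, rfl⟩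

theorem FactorsFree.add {f g : X →ₗ[A] Y} (hf : FactorsFree f) (hg : FactorsFree g) :
    FactorsFree (f + g) := by
  obtain ⟨ι, a, b, rfl⟩ := hf
  obtain ⟨κ, c, d, rfl⟩ := hg
  have := factorsFree_comp_of_projective (a.prod c) (b.coprod d)
  rwa [LinearMap.coprod_comp_prod] at this

theorem FactorsFree.sum {ι : Type} (s : Finset ι) {f : ι → X →ₗ[A] Y}
    (hf : ∀ i, FactorsFree (f i)) : FactorsFree (∑ i ∈ s, f i) := by
  classical
  induction s using Finset.induction_on with
  | empty => exact FactorsFree.zero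
  | insert i s hi ih =>
    rw [Finset.sum_insert hi]
    exact (hf i).add ih

theorem FactorsFree.exists_lift {f : N →ₗ[A] Z} (hf : FactorsFree f) (q : Y →ₗ[A] Z)
    (hq : Function.Surjective q) : ∃ u : N →ₗ[A] Y, FactorsFree u ∧ q ∘ₗ u = f := by
  obtain ⟨ι, g, h, rfl⟩ := hf
  obtain ⟨u, hu⟩ := Module.projective_lifting_property q h hq
  exact ⟨u ∘ₗ g, ⟨ι, g, u, rfl⟩, by rw [← LinearMap.comp_assoc, hu]⟩

theorem FactorsFree.exists_extend [IsNoetherianRing A] [Module.Injective A A] {f : N →ₗ[A] Z}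
    (hf : FactorsFree f) (j : N →ₗ[A] Y) (hj : Function.Injective j) :
    ∃ u : Y →ₗ[A] Z, u ∘ₗ j = f := by
  obtain ⟨ι, g, h, rfl⟩ := hf
  obtain ⟨u, hu⟩ := (injective_finsupp_self (A := A) ι).out j hj g
  exact ⟨h ∘ₗ u, LinearMap.ext fun x => congrArg h (hu x)⟩

theorem FactorsFree.exists_sum [Module.Finite A N] {f : N →ₗ[A] Y} (hf : FactorsFree f) :
    ∃ (ι : Type) (s : Finset ι) (g : ι → N →ₗ[A] A) (y : ι → Y),
      f = ∑ i ∈ s, LinearMap.toSpanSingleton A Y (y i) ∘ₗ g i := by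
  obtain ⟨ι, g, h, rfl⟩ := hf
  obtain ⟨s, hs⟩ := exists_eq_sum_finsupp g
  refine ⟨ι, s, fun i => Finsupp.lapply i ∘ₗ g, fun i => h (Finsupp.single i 1), ?_⟩
  ext x
  have hx := congrArg h (LinearMap.congr_fun hs x)
  rw [LinearMap.sum_apply, map_sum] at hx
  rw [LinearMap.comp_apply, hx, LinearMap.sum_apply]
  refine Finset.sum_congr rfl fun i _ => ?_
  simp only [LinearMap.comp_apply, LinearMap.toSpanSingleton_apply, Finsupp.lsingle_apply]
  rw [← map_smul, Finsupp.smul_single, smul_eq_mul, mul_one]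

/-- Every linear map from `N` to `Y` factors through a free module. -/
def StZero (A : Type) [Ring A] (N Y : Type) [AddCommGroup N] [Module A N] [AddCommGroup Y]
    [Module A Y] : Prop := ∀ f : N →ₗ[A] Y, FactorsFree f

theorem StZero.directSum [Module.Finite A N] {ι : Type} {W : ι → Type}
    [∀ i, AddCommGroup (W i)] [∀ i, Module A (W i)] (h : ∀ i, StZero A N (W i)) :
    StZero A N (DirectSum ι W) := by
  classical
  intro f
  obtain ⟨s, hs⟩ := exists_eq_sum_directSum f
  rw [hs]
  exact FactorsFree.sum _ fun i => (h i _).comp_left _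

end ProjectiveInjective

section SClosure

variable {A : Type} [Ring A]

theorem isSClosedClass_memS (M : ModuleCat.{0} A) : IsSClosedClass A M (MemS A M) :=
  ⟨fun _ h => h.1, fun X Y hX e P h => h.2.1 X Y (hX P h) e,
    fun X Y hY e P h => h.2.2.1 X Y (hY P h) e,
    fun I Y hY P h => h.2.2.2.1 I Y fun i => hY i P h,
    fun X Y Z f g hf hg hfg =>
      ⟨fun hXY P h => (h.2.2.2.2 X Y Z f g hf hg hfg).1 ⟨hXY.1 P h, hXY.2 P h⟩,
        fun hXZ P h => (h.2.2.2.2 X Y Z f g hf hg hfg).2.1 ⟨hXZ.1 P h, hXZ.2 P h⟩,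
        fun hYZ P h => (h.2.2.2.2 X Y Z f g hf hg hfg).2.2 ⟨hYZ.1 P h, hYZ.2 P h⟩⟩⟩

theorem MemS.of_retract {M X Y : ModuleCat.{0} A} (hY : MemS A M Y) (i : X →ₗ[A] Y)
    (r : Y →ₗ[A] X) (h : r ∘ₗ i = LinearMap.id) : MemS A M X :=
  (isSClosedClass_memS M).2.2.1 X Y hY
    ⟨ModuleCat.ofHom i, ModuleCat.ofHom r, by ext x; exact LinearMap.congr_fun h x⟩

theorem memS_directSum {M : ModuleCat.{0} A} {ι : Type} [DecidableEq ι]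
    (Y : ι → ModuleCat.{0} A) (hY : ∀ i, MemS A M (Y i)) :
    MemS A M (ModuleCat.of A (DirectSum ι fun i => Y i)) :=
  (isSClosedClass_memS M).2.1 _ _ ((isSClosedClass_memS M).2.2.2.1 ι Y hY)
    ⟨ModuleCat.coprodIsoDirectSum Y⟩

theorem memS_finsupp {M : ModuleCat.{0} A} (ι : Type) : MemS A M (ModuleCat.of A (ι →₀ M)) := by
  classical
  refine MemS.of_retract (memS_directSum (fun _ : ι => M) fun _ => (isSClosedClass_memS M).1)
    (finsuppLEquivDirectSum A M ι).toLinearMap (finsuppLEquivDirectSum A M ι).symm.toLinearMap ?_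
  ext
  simp

theorem memS_right {M X Y Z : ModuleCat.{0} A} {f : X →ₗ[A] Y} {g : Y →ₗ[A] Z}
    (hf : Function.Injective f) (hg : Function.Surjective g)
    (h : LinearMap.range f = LinearMap.ker g) (hX : MemS A M X) (hY : MemS A M Y) :
    MemS A M Z :=
  ((isSClosedClass_memS M).2.2.2.2 X Y Z (ModuleCat.ofHom f) (ModuleCat.ofHom g) hf hg h).1
    ⟨hX, hY⟩

theorem memS_middle {M X Y Z : ModuleCat.{0} A} {f : X →ₗ[A] Y} {g : Y →ₗ[A] Z}
    (hf : Function.Injective f) (hg : Function.Surjective g)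
    (h : LinearMap.range f = LinearMap.ker g) (hX : MemS A M X) (hZ : MemS A M Z) :
    MemS A M Y :=
  ((isSClosedClass_memS M).2.2.2.2 X Y Z (ModuleCat.ofHom f) (ModuleCat.ofHom g) hf hg h).2.1
    ⟨hX, hZ⟩

/-- Over a generator `M`, every projective module is a retract of a direct sum of copies
of `M`. -/
theorem IsGen.exists_retract_finsupp {M : ModuleCat.{0} A} (hgen : IsGen A M) (X : Type)
    [AddCommGroup X] [Module A X] [Module.Projective A X] :
    ∃ (J : Type) (i : X →ₗ[A] (J →₀ M)) (r : (J →₀ M) →ₗ[A] X), r ∘ₗ i = LinearMap.id := by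
  obtain ⟨n, Y, ⟨e⟩⟩ := hgen
  obtain ⟨s, hs⟩ := Module.projective_def'.1 (inferInstance : Module.Projective A X)
  let e' : (A × Y) ≃ₗ[A] (Fin n →₀ M) := e.trans (Finsupp.linearEquivFunOnFinite A M (Fin n)).symm
  let a : A →ₗ[A] (Fin n →₀ M) := e'.toLinearMap ∘ₗ LinearMap.inl A A Y
  let b : (Fin n →₀ M) →ₗ[A] A := LinearMap.fst A A Y ∘ₗ e'.symm.toLinearMap
  have hba : b ∘ₗ a = LinearMap.id := by
    ext
    simp [a, b]
  let c := Finsupp.curryLinearEquiv (α := X) (β := Fin n) (M := M) A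
  refine ⟨X × Fin n, c.symm.toLinearMap ∘ₗ Finsupp.mapRange.linearMap a ∘ₗ s,
    Finsupp.linearCombination A id ∘ₗ Finsupp.mapRange.linearMap b ∘ₗ c.toLinearMap, ?_⟩
  have hba' : Finsupp.mapRange.linearMap (α := X) b ∘ₗ Finsupp.mapRange.linearMap a =
      LinearMap.id := by
    rw [← Finsupp.mapRange.linearMap_comp, hba, Finsupp.mapRange.linearMap_id]
  ext x
  simp only [LinearMap.comp_apply, LinearEquiv.coe_coe, LinearEquiv.apply_symm_apply]
  rw [← LinearMap.comp_apply (Finsupp.mapRange.linearMap b), hba']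
  exact LinearMap.congr_fun hs x

theorem IsGen.memS_of_projective {M : ModuleCat.{0} A} (hgen : IsGen A M) (X : ModuleCat.{0} A)
    [Module.Projective A X] : MemS A M X := by
  obtain ⟨J, i, r, h⟩ := hgen.exists_retract_finsupp X
  exact MemS.of_retract (memS_finsupp J) i r h

theorem memAddBig_of_retract {M X : ModuleCat.{0} A} {J : Type} (i : X →ₗ[A] (J →₀ M))
    (r : (J →₀ M) →ₗ[A] X) (h : r ∘ₗ i = LinearMap.id) : MemAddBig A M X := by
  have hri (x : X) : r (i x) = x := LinearMap.congr_fun h x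
  refine ⟨J, ModuleCat.of A (LinearMap.ker r), ⟨LinearEquiv.ofBijective
    (i.coprod (LinearMap.ker r).subtype) ⟨(injective_iff_map_eq_zero _).2 ?_, fun z => ?_⟩⟩⟩
  · rintro ⟨x, y⟩ hxy
    have hxy' : i x + (y : J →₀ M) = 0 := hxy
    have h1 := congrArg r hxy'
    have hy : r (y : J →₀ M) = 0 := y.2
    rw [map_add, hri, hy, add_zero, map_zero] at h1
    rw [h1, map_zero, zero_add] at hxy'
    exact Prod.ext h1 (Subtype.ext hxy')
  · refine ⟨(r z, ⟨z - i (r z), ?_⟩), ?_⟩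
    · rw [LinearMap.mem_ker, map_sub, hri, sub_self]
    · exact add_sub_cancel (i (r z)) z

theorem MemAddBig.exists_retract {M X : ModuleCat.{0} A} (h : MemAddBig A M X) :
    ∃ (J : Type) (i : X →ₗ[A] (J →₀ M)) (r : (J →₀ M) →ₗ[A] X), r ∘ₗ i = LinearMap.id := by
  obtain ⟨J, Y, ⟨e⟩⟩ := h
  exact ⟨J, e.toLinearMap ∘ₗ LinearMap.inl A X Y, LinearMap.fst A X Y ∘ₗ e.symm.toLinearMap,
    by ext; simp⟩

theorem isSClosedClass_projective [IsNoetherianRing A] [Module.Injective A A]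
    (M : ModuleCat.{0} A) [Module.Projective A M] :
    IsSClosedClass A M fun X => Module.Projective A X := by
  classical
  refine ⟨inferInstance, fun X Y hX ⟨e⟩ => Module.Projective.of_equiv e.toLinearEquiv, ?_, ?_, ?_⟩
  · rintro X Y hY ⟨i, r, h⟩
    exact Module.Projective.of_split i.hom r.hom (congrArg ModuleCat.Hom.hom h)
  · intro I Y hY
    exact Module.Projective.of_equiv (ModuleCat.coprodIsoDirectSum Y).toLinearEquiv.symm
  · intro X Y Z f g hf hg hfg
    have hex : Function.Exact f.hom g.hom := LinearMap.exact_iff.2 hfg.symm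
    refine ⟨fun ⟨hX, hY⟩ => ?_, fun ⟨hX, hZ⟩ => ?_, fun ⟨hY, hZ⟩ => ?_⟩
    · have := injective_of_projective (A := A) (X := X)
      obtain ⟨l, hl⟩ := Module.Injective.out f.hom hf LinearMap.id
      let e := (hex.splitInjectiveEquiv hg ⟨l, LinearMap.ext hl⟩).1
      exact Module.Projective.of_split (e.symm.toLinearMap ∘ₗ LinearMap.inr A X Z)
        (LinearMap.snd A X Z ∘ₗ e.toLinearMap) (by ext; simp)
    · obtain ⟨l, hl⟩ := Module.projective_lifting_property g.hom LinearMap.id hg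
      exact Module.Projective.of_equiv (hex.splitSurjectiveEquiv hf ⟨l, hl⟩).1.symm
    · obtain ⟨l, hl⟩ := Module.projective_lifting_property g.hom LinearMap.id hg
      let e := (hex.splitSurjectiveEquiv hf ⟨l, hl⟩).1
      exact Module.Projective.of_split (e.symm.toLinearMap ∘ₗ LinearMap.inl A X Z)
        (LinearMap.fst A X Z ∘ₗ e.toLinearMap) (by ext; simp)

theorem memAddBig_of_memS_of_projective [IsNoetherianRing A] [Module.Injective A A]
    {M X : ModuleCat.{0} A} (hgen : IsGen A M) [Module.Projective A M] (hX : MemS A M X) :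
    MemAddBig A M X := by
  have := hX _ (isSClosedClass_projective M)
  obtain ⟨J, i, r, h⟩ := hgen.exists_retract_finsupp X
  exact memAddBig_of_retract i r h

end SClosure

section NakayamaDuality

variable (k : Type) {A : Type} [Field k] [Ring A] [Algebra k A]
variable {N N' I X : Type} [AddCommGroup N] [Module A N] [AddCommGroup N'] [Module A N']
  [AddCommGroup I] [Module A I]
  [AddCommGroup X] [Module A X] [Module k X] [IsScalarTower k A X]

theorem NuCarrier.smul_apply (a : A) (φ : NuCarrier k A N) (f : N →ₗ[A] A) :
    (a • φ) f = φ (rmulHom k A N a f) := rfl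

theorem NuCarrier.algebraMap_smul (c : k) (φ : NuCarrier k A N) :
    algebraMap k A c • φ = c • φ := by
  refine LinearMap.ext fun f => ?_
  rw [NuCarrier.smul_apply, LinearMap.smul_apply, ← map_smul]
  congr 1
  ext x
  simp [Algebra.smul_def, Algebra.commutes]

/-- Precomposition with `f` as a `k`-linear map. -/
def precompLin (Y : Type) [AddCommGroup Y] [Module A Y] [Module k Y] [IsScalarTower k A Y]
    (f : N →ₗ[A] N') : (N' →ₗ[A] Y) →ₗ[k] (N →ₗ[A] Y) where
  toFun u := u ∘ₗ f
  map_add' _ _ := rfl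
  map_smul' _ _ := rfl

/-- Functoriality of the Nakayama functor. -/
def nuMap (f : N →ₗ[A] N') : NuCarrier k A N →ₗ[A] NuCarrier k A N' where
  toFun φ := φ ∘ₗ precompLin k A f
  map_add' _ _ := rfl
  map_smul' _ _ := rfl

theorem nuMap_apply (f : N →ₗ[A] N') (φ : NuCarrier k A N) (u : N' →ₗ[A] A) :
    nuMap k f φ u = φ (u ∘ₗ f) := rfl

variable {k}

/-- The map `D Hom_A(N, X) → Hom_A(X, ν N)`. -/
def nuPairing (ψ : (N →ₗ[A] X) →ₗ[k] k) : X →ₗ[A] NuCarrier k A N where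
  toFun x :=
    { toFun := fun f => ψ (LinearMap.toSpanSingleton A X x ∘ₗ f)
      map_add' := fun f g => by rw [LinearMap.comp_add, map_add]
      map_smul' := fun c f => by
        rw [RingHom.id_apply, ← map_smul]
        congr 1
        ext y
        simp }
  map_add' x y := by
    refine LinearMap.ext fun f => ?_
    change ψ _ = ψ _ + ψ _
    rw [← map_add]
    congr 1
    ext z
    simp
  map_smul' a x := by
    refine LinearMap.ext fun f => ?_
    change ψ _ = ψ _
    congr 1
    ext z
    simp [mul_smul]

theorem nuPairing_apply (ψ : (N →ₗ[A] X) →ₗ[k] k) (x : X) (f : N →ₗ[A] A) :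
    nuPairing ψ x f = ψ (LinearMap.toSpanSingleton A X x ∘ₗ f) := rfl

theorem nuMap_nuPairing (f : N →ₗ[A] N') (ψ : (N →ₗ[A] X) →ₗ[k] k) (x : X) :
    nuMap k f (nuPairing ψ x) = nuPairing (ψ ∘ₗ precompLin k X f) x := rfl

theorem exists_nuPairing_eq_of_projective [Module.Finite A I] [Module.Projective A I]
    (Φ : X →ₗ[A] NuCarrier k A I) : ∃ ψ : (I →ₗ[A] X) →ₗ[k] k, nuPairing ψ = Φ := by
  obtain ⟨n, π, hπ⟩ := Module.Finite.exists_fin' A I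
  obtain ⟨s, hs⟩ := Module.projective_lifting_property π LinearMap.id hπ
  let b (i : Fin n) : I := π (Pi.single i 1)
  let b' (i : Fin n) : I →ₗ[A] A := LinearMap.proj i ∘ₗ s
  have hb (y : I) : ∑ i, b' i y • b i = y := by
    have h1 : s y = ∑ i, s y i • (Pi.single i 1 : Fin n → A) := by
      simpa using (pi_eq_sum_univ' (s y))
    have h2 := LinearMap.congr_fun hs y
    rw [LinearMap.comp_apply, h1, map_sum] at h2
    simpa [b, b'] using h2
  refine ⟨{ toFun := fun h => ∑ i, Φ (h (b i)) (b' i), map_add' := ?_, map_smul' := ?_ }, ?_⟩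
  · intro f g
    simp [Finset.sum_add_distrib]
  · intro c f
    rw [RingHom.id_apply, Finset.smul_sum]
    refine Finset.sum_congr rfl fun i _ => ?_
    rw [LinearMap.smul_apply, ← algebraMap_smul A c (f (b i)), map_smul,
      NuCarrier.algebraMap_smul]
    rfl
  · ext x : 1
    refine LinearMap.ext fun f => ?_
    change ∑ i, Φ (f (b i) • x) (b' i) = Φ x f
    simp only [map_smul, NuCarrier.smul_apply]
    rw [← map_sum]
    congr 1
    ext y
    conv_rhs => rw [← hb y, map_sum]
    simp

theorem exists_comp_precompLin_eq (f : N →ₗ[A] N') (ψ : (N' →ₗ[A] X) →ₗ[k] k)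
    (h : ∀ u : N' →ₗ[A] X, u ∘ₗ f = 0 → ψ u = 0) :
    ∃ ψ' : (N →ₗ[A] X) →ₗ[k] k, ψ' ∘ₗ precompLin k X f = ψ := by
  have : ψ ∈ LinearMap.range (precompLin k X f).dualMap := by
    rw [LinearMap.range_dualMap_eq_dualAnnihilator_ker, Submodule.mem_dualAnnihilator]
    exact h
  exact this

variable (k) in
theorem nuMap_injective [Module.Injective A A] (f : N →ₗ[A] N')
    (hf : Function.Injective f) :
    Function.Injective (nuMap k f) := by
  refine (injective_iff_map_eq_zero _).2 fun φ hφ => LinearMap.ext fun u => ?_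
  obtain ⟨v, hv⟩ := Module.Injective.out f hf u
  have hv' : v ∘ₗ f = u := LinearMap.ext hv
  rw [← hv', ← nuMap_apply, hφ]
  rfl

variable (k) in
theorem nuMap_surjective (f : N →ₗ[A] N') (hf : Function.Surjective f) :
    Function.Surjective (nuMap k f) := by
  intro φ
  obtain ⟨ψ, hψ⟩ := LinearMap.dualMap_surjective_of_injective (f := precompLin k A f)
    (fun u v huv => (LinearMap.cancel_right hf).1 huv) φ
  exact ⟨ψ, hψ⟩

theorem exists_comp_eq_of_comp_eq_zero {f : N →ₗ[A] I} {g : I →ₗ[A] N'}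
    (hg : Function.Surjective g) (h : LinearMap.range f = LinearMap.ker g) (u : I →ₗ[A] X)
    (hu : u ∘ₗ f = 0) : ∃ v : N' →ₗ[A] X, v ∘ₗ g = u := by
  have hker : LinearMap.ker g ≤ LinearMap.ker u := by
    rw [← h]
    rintro _ ⟨x, rfl⟩
    exact LinearMap.congr_fun hu x
  refine ⟨(LinearMap.ker g).liftQ u hker ∘ₗ (g.quotKerEquivOfSurjective hg).symm.toLinearMap, ?_⟩
  ext x
  have : (g.quotKerEquivOfSurjective hg).symm (g x) = (LinearMap.ker g).mkQ x := by
    rw [LinearEquiv.symm_apply_eq]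
    rfl
  rw [LinearMap.comp_apply, LinearMap.comp_apply, LinearEquiv.coe_coe, this]
  rfl

variable (k) in
theorem range_nuMap_eq_ker {f : N →ₗ[A] I} {g : I →ₗ[A] N'}
    (hg : Function.Surjective g) (h : LinearMap.range f = LinearMap.ker g) :
    LinearMap.range (nuMap k f) = LinearMap.ker (nuMap k g) := by
  apply le_antisymm
  · rintro _ ⟨φ, rfl⟩
    refine LinearMap.ext fun u => ?_
    rw [nuMap_apply, nuMap_apply, LinearMap.comp_assoc]
    have : g ∘ₗ f = 0 := by
      ext x
      exact (h ▸ LinearMap.mem_range_self f x : f x ∈ LinearMap.ker g)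
    rw [this, LinearMap.comp_zero, map_zero]
    rfl
  · intro φ hφ
    obtain ⟨ψ, hψ⟩ := exists_comp_precompLin_eq (X := A) f φ fun u hu => by
      obtain ⟨v, rfl⟩ := exists_comp_eq_of_comp_eq_zero (X := A) hg h u hu
      exact LinearMap.congr_fun (LinearMap.mem_ker.1 hφ) v
    exact ⟨ψ, hψ⟩

/-- The Nakayama functor sends finitely generated projective modules to injective modules. -/
theorem injective_nuCarrier [Module.Finite A I] [Module.Projective A I] :
    Module.Injective A (NuCarrier k A I) where
  out Y Z _ _ _ _ f hf Φ := by
    let := Module.compHom Y (algebraMap k A)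
    let := Module.compHom Z (algebraMap k A)
    have : IsScalarTower k A Y := IsScalarTower.of_algebraMap_smul fun _ _ => rfl
    have : IsScalarTower k A Z := IsScalarTower.of_algebraMap_smul fun _ _ => rfl
    obtain ⟨ψ, rfl⟩ := exists_nuPairing_eq_of_projective Φ
    let F : (I →ₗ[A] Y) →ₗ[k] (I →ₗ[A] Z) :=
      { toFun := fun u => f ∘ₗ u
        map_add' := fun u v => LinearMap.comp_add _ _ _
        map_smul' := fun c u => by
          ext x
          change f (algebraMap k A c • u x) = algebraMap k A c • f (u x)
          rw [map_smul] }
    obtain ⟨ψ', hψ'⟩ := LinearMap.dualMap_surjective_of_injective (f := F)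
      (fun u v huv => (LinearMap.cancel_left hf).1 huv) ψ
    refine ⟨nuPairing ψ', fun x => LinearMap.ext fun u => ?_⟩
    rw [nuPairing_apply, nuPairing_apply, ← hψ']
    change ψ' _ = ψ' _
    congr 1
    ext y
    simp [F]

/-- If every map from the cosyzygy `N'` of `N` to `X` factors through a free module, then every
map `X → ν N` comes from a functional on `Hom_A(N, X)`. -/
theorem exists_nuPairing_eq [Module.Injective A A] [Module.Finite A I] [Module.Projective A I]
    {f : N →ₗ[A] I} {g : I →ₗ[A] N'} (hf : Function.Injective f) (hg : Function.Surjective g)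
    (h : LinearMap.range f = LinearMap.ker g) (hst : StZero A N' X)
    (Φ : X →ₗ[A] NuCarrier k A N) : ∃ ψ : (N →ₗ[A] X) →ₗ[k] k, nuPairing ψ = Φ := by
  have : Module.Finite A N' := Module.Finite.of_surjective g hg
  obtain ⟨ψ, hψ⟩ := exists_nuPairing_eq_of_projective (nuMap k f ∘ₗ Φ)
  have hgf : g ∘ₗ f = 0 := by
    ext x
    exact (h ▸ LinearMap.mem_range_self f x : f x ∈ LinearMap.ker g)
  obtain ⟨ψ', hψ'⟩ := exists_comp_precompLin_eq f ψ fun u hu => by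
    obtain ⟨v, rfl⟩ := exists_comp_eq_of_comp_eq_zero hg h u hu
    obtain ⟨ι, s, a, y, rfl⟩ := (hst v).exists_sum
    have hsum : (∑ i ∈ s, LinearMap.toSpanSingleton A X (y i) ∘ₗ a i) ∘ₗ g =
        ∑ i ∈ s, (LinearMap.toSpanSingleton A X (y i) ∘ₗ a i) ∘ₗ g := by
      ext z
      simp
    rw [hsum, map_sum]
    refine Finset.sum_eq_zero fun i _ => ?_
    rw [LinearMap.comp_assoc, ← nuPairing_apply, hψ, LinearMap.comp_apply, nuMap_apply,
      LinearMap.comp_assoc, hgf, LinearMap.comp_zero, map_zero]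
  refine ⟨ψ', LinearMap.ext fun x => nuMap_injective k f hf ?_⟩
  rw [nuMap_nuPairing, hψ', hψ]
  rfl

theorem exists_nuMap_comp_eq [Module.Injective A A] [Module.Finite A I] [Module.Projective A I]
    {f : N →ₗ[A] I} {g : I →ₗ[A] N'} (hf : Function.Injective f) (hg : Function.Surjective g)
    (h : LinearMap.range f = LinearMap.ker g) (hst : StZero A N' X)
    {F : Type} [AddCommGroup F] [Module A F] (q : F →ₗ[A] N) (hq : Function.Surjective q)
    (Φ : X →ₗ[A] NuCarrier k A N) : ∃ Φ' : X →ₗ[A] NuCarrier k A F, nuMap k q ∘ₗ Φ' = Φ := by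
  obtain ⟨ψ, rfl⟩ := exists_nuPairing_eq hf hg h hst Φ
  obtain ⟨ψ', hψ'⟩ := LinearMap.dualMap_surjective_of_injective (f := precompLin k X q)
    (fun u v huv => (LinearMap.cancel_right hq).1 huv) ψ
  refine ⟨nuPairing ψ', LinearMap.ext fun x => ?_⟩
  rw [← hψ']
  rfl

end NakayamaDuality

section Coresolution

variable {A : Type} [Ring A]

theorem exists_comp_eq_of_comp_eq_zero' {N X Y Z : Type} [AddCommGroup N] [Module A N]
    [AddCommGroup X] [Module A X] [AddCommGroup Y] [Module A Y] [AddCommGroup Z] [Module A Z]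
    {f : X →ₗ[A] Y} {g : Y →ₗ[A] Z} (hf : Function.Injective f)
    (h : LinearMap.range f = LinearMap.ker g) (u : N →ₗ[A] Y) (hu : g ∘ₗ u = 0) :
    ∃ v : N →ₗ[A] X, f ∘ₗ v = u := by
  let e := LinearEquiv.ofInjective f hf
  refine ⟨e.symm.toLinearMap ∘ₗ u.codRestrict (LinearMap.range f) fun x =>
    h ▸ LinearMap.congr_fun hu x, LinearMap.ext fun x => ?_⟩
  exact congrArg Subtype.val (e.apply_symm_apply _)

/-- A coresolution by finitely generated projective modules, together with its cosyzygies. -/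
structure ProjCoresolution (A : Type) [Ring A] where
  /-- the cosyzygies -/
  C : ℕ → ModuleCat.{0} A
  /-- the terms of the coresolution -/
  I : ℕ → ModuleCat.{0} A
  /-- the inclusions of the cosyzygies -/
  ι : ∀ n, C n →ₗ[A] I n
  /-- the projections onto the next cosyzygies -/
  p : ∀ n, I n →ₗ[A] C (n + 1)
  ι_injective : ∀ n, Function.Injective (ι n)
  p_surjective : ∀ n, Function.Surjective (p n)
  range_eq_ker : ∀ n, LinearMap.range (ι n) = LinearMap.ker (p n)
  finite : ∀ n, Module.Finite A (C n)
  finite_term : ∀ n, Module.Finite A (I n)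
  projective_term : ∀ n, Module.Projective A (I n)

attribute [instance] ProjCoresolution.finite ProjCoresolution.finite_term
  ProjCoresolution.projective_term

/-- The sequence `C` with its initial term replaced by `M`. -/
def replaceZero (M : ModuleCat.{0} A) (C : ℕ → ModuleCat.{0} A) : ℕ → ModuleCat.{0} A
  | 0 => M
  | n + 1 => C (n + 1)

theorem IsMinInjCoresolution.exists_projCoresolution [IsArtinianRing A] [Module.Injective A A]
    {M : ModuleCat.{0} A} [Module.Finite A M] {C : ℕ → ModuleCat.{0} A}
    (hC : IsMinInjCoresolution A M C) : ∃ R : ProjCoresolution A, R.C 0 = M ∧ R.C 1 = C 1 := by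
  obtain ⟨⟨e⟩, hC⟩ := hC
  have hfin (n : ℕ) : Module.Finite A (C n) := by
    induction n with
    | zero => exact Module.Finite.equiv e.toLinearEquiv.symm
    | succ n ih =>
      obtain ⟨I, ι, p, hι, hp, -⟩ := hC n
      have := (finite_projective_of_isInjEnvelope hι).1
      exact Module.Finite.of_surjective p.hom hp
  choose I ι p hι hp hex using hC
  have hI (n : ℕ) := finite_projective_of_isInjEnvelope (hι n)
  let j (n : ℕ) : replaceZero M C n ≃ₗ[A] C n := match n with
    | 0 => e.toLinearEquiv.symm
    | n + 1 => LinearEquiv.refl A (C (n + 1))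
  exact ⟨{
    C := replaceZero M C
    I := I
    ι := fun n => (ι n).hom ∘ₗ (j n).toLinearMap
    p := fun n => (p n).hom
    ι_injective := fun n => (hι n).2.1.comp (j n).injective
    p_surjective := hp
    range_eq_ker := fun n => by
      rw [LinearMap.range_comp, LinearEquiv.range, Submodule.map_top]
      exact hex n
    finite := fun n => Module.Finite.equiv (j n).symm
    finite_term := fun n => (hI n).1
    projective_term := fun n => (hI n).2 }, rfl, rfl⟩

namespace ProjCoresolution

variable (R : ProjCoresolution A)

theorem p_comp_ι (n : ℕ) : R.p n ∘ₗ R.ι n = 0 := by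
  ext x
  exact (R.range_eq_ker n ▸ LinearMap.mem_range_self (R.ι n) x :
    R.ι n x ∈ LinearMap.ker (R.p n))

theorem memS_C (hgen : IsGen A (R.C 0)) (n : ℕ) : MemS A (R.C 0) (R.C n) := by
  induction n with
  | zero => exact (isSClosedClass_memS _).1
  | succ n ih =>
    exact memS_right (R.ι_injective n) (R.p_surjective n) (R.range_eq_ker n) ih
      (hgen.memS_of_projective _)

variable [IsNoetherianRing A] [Module.Injective A A]

theorem subsingleton_ext (hso : SelfOrthogonal A (R.C 0)) (j n : ℕ) :
    Subsingleton (Abelian.Ext (R.C 0) (R.C j) (n + 1)) := by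
  induction j generalizing n with
  | zero => exact (extZero_succ_iff_subsingleton n _ _).1 (hso (n + 1) (by omega))
  | succ j ih =>
    exact (subsingleton_ext_succ_left_iff_of_injective (R.ι_injective j) (R.p_surjective j)
      (R.range_eq_ker j) (R.C 0) injective_of_projective n).2 (ih (n + 1))

theorem stZero_zero (hso : SelfOrthogonal A (R.C 0)) (j : ℕ) :
    StZero A (R.C 0) (R.C (j + 1)) := by
  intro f
  obtain ⟨v, rfl⟩ := exists_lift_of_subsingleton_ext_one (R.ι_injective j) (R.p_surjective j)
      (R.range_eq_ker j) (R.C 0) (R.subsingleton_ext hso j 0) f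
  exact factorsFree_comp_of_projective v (R.p j)

theorem stZero_one (hso : SelfOrthogonal A (R.C 0)) (j : ℕ) :
    StZero A (R.C 1) (R.C (j + 2)) := by
  intro f
  obtain ⟨u, hu⟩ := Module.projective_lifting_property (R.p (j + 1)) (f ∘ₗ R.p 0)
    (R.p_surjective (j + 1))
  obtain ⟨w, hw⟩ := exists_comp_eq_of_comp_eq_zero' (R.ι_injective (j + 1))
    (R.range_eq_ker (j + 1)) (u ∘ₗ R.ι 0) (by
      rw [← LinearMap.comp_assoc, hu, LinearMap.comp_assoc, R.p_comp_ι, LinearMap.comp_zero])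
  obtain ⟨w', hw'⟩ := (R.stZero_zero hso j w).exists_extend (R.ι 0) (R.ι_injective 0)
  obtain ⟨v, hv⟩ := exists_comp_eq_of_comp_eq_zero (R.p_surjective 0) (R.range_eq_ker 0)
    (u - R.ι (j + 1) ∘ₗ w') (by
      rw [LinearMap.sub_comp, LinearMap.comp_assoc, hw', hw, sub_self])
  have : f = R.p (j + 1) ∘ₗ v := by
    rw [← LinearMap.cancel_right (R.p_surjective 0), LinearMap.comp_assoc, hv, LinearMap.comp_sub,
      ← LinearMap.comp_assoc, R.p_comp_ι, hu, LinearMap.zero_comp, sub_zero]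
  rw [this]
  exact factorsFree_comp_of_projective v (R.p (j + 1))

end ProjCoresolution

end Coresolution

section Pushout

variable {A : Type} [Ring A]

theorem exists_pushout {X K I L : Type} [AddCommGroup X] [Module A X] [AddCommGroup K] [Module A K]
    [AddCommGroup I] [Module A I] [AddCommGroup L] [Module A L] {f : K →ₗ[A] I} {g : I →ₗ[A] L}
    (hf : Function.Injective f) (hg : Function.Surjective g)
    (h : LinearMap.range f = LinearMap.ker g) (ev : K →ₗ[A] X) :
    ∃ (E : ModuleCat.{0} A) (i : X →ₗ[A] E) (π : E →ₗ[A] L) (j : I →ₗ[A] E),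
      Function.Injective i ∧ Function.Surjective π ∧ LinearMap.range i = LinearMap.ker π ∧
        j ∘ₗ f = i ∘ₗ ev := by
  let T := LinearMap.range (ev.prod (-f))
  have hT : T ≤ LinearMap.ker (g ∘ₗ LinearMap.snd A X I) := by
    rintro _ ⟨z, rfl⟩
    have : f z ∈ LinearMap.ker g := h ▸ LinearMap.mem_range_self f z
    simpa using this
  let π : ((X × I) ⧸ T) →ₗ[A] L := T.liftQ (g ∘ₗ LinearMap.snd A X I) hT
  refine ⟨ModuleCat.of A ((X × I) ⧸ T), T.mkQ ∘ₗ LinearMap.inl A X I, π,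
    T.mkQ ∘ₗ LinearMap.inr A X I, ?_, ?_, le_antisymm ?_ ?_, ?_⟩
  · rw [← LinearMap.ker_eq_bot, LinearMap.ker_eq_bot']
    intro x hx
    obtain ⟨z, hz⟩ := (Submodule.Quotient.mk_eq_zero T).1 hx
    obtain ⟨h1, h2⟩ := Prod.ext_iff.1 hz
    have hz0 : z = 0 := hf (by simpa using h2)
    simpa [hz0] using h1.symm
  · intro y
    obtain ⟨w, rfl⟩ := hg y
    exact ⟨T.mkQ (0, w), rfl⟩
  · rintro _ ⟨x, rfl⟩
    exact g.map_zero
  · intro y hy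
    obtain ⟨⟨x, w⟩, rfl⟩ := T.mkQ_surjective y
    have hw : w ∈ LinearMap.range f := h ▸ (hy : g w = 0)
    obtain ⟨z, rfl⟩ := hw
    refine ⟨x + ev z, (Submodule.Quotient.eq T).2 ⟨z, ?_⟩⟩
    simp
  · refine LinearMap.ext fun z => Eq.symm ((Submodule.Quotient.eq T).2 ⟨z, ?_⟩)
    simp

theorem exists_pushout_family {X : ModuleCat.{0} A} {S : Type} [DecidableEq S]
    {K I L : S → ModuleCat.{0} A} {f : ∀ s, K s →ₗ[A] I s} {g : ∀ s, I s →ₗ[A] L s}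
    (hf : ∀ s, Function.Injective (f s)) (hg : ∀ s, Function.Surjective (g s))
    (h : ∀ s, LinearMap.range (f s) = LinearMap.ker (g s)) (ev : ∀ s, K s →ₗ[A] X) :
    ∃ (E : ModuleCat.{0} A) (i : X →ₗ[A] E) (π : E →ₗ[A] DirectSum S fun s => L s),
      Function.Injective i ∧ Function.Surjective π ∧ LinearMap.range i = LinearMap.ker π ∧
        ∀ s, ∃ j : I s →ₗ[A] E, j ∘ₗ f s = i ∘ₗ ev s := by
  obtain ⟨E, i, π, j, hi, hπ, hiπ, hj⟩ := exists_pushout (f := DirectSum.lmap f)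
    (g := DirectSum.lmap g) ((DirectSum.lmap_injective f).2 hf) ((DirectSum.lmap_surjective g).2 hg)
    (by
      ext x
      rw [DirectSum.range_lmap, DirectSum.ker_lmap]
      simp only [h])
    (DirectSum.toModule A S X ev)
  refine ⟨E, i, π, hi, hπ, hiπ, fun s => ⟨j ∘ₗ DirectSum.lof A S (fun s => I s) s, ?_⟩⟩
  ext z
  have := LinearMap.congr_fun hj (DirectSum.lof A S (fun s => K s) s z)
  simpa using this

end Pushout

section Telescope

variable {A : Type} [Ring A] {X : ℕ → ModuleCat.{0} A} (i : ∀ n, X n →ₗ[A] X (n + 1))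

/-- The difference of the identity and the shift on the direct sum of a sequence of modules. -/
noncomputable def telescopeMap :
    (DirectSum ℕ fun n => X n) →ₗ[A] DirectSum ℕ fun n => X n :=
  DirectSum.toModule A ℕ _ fun n =>
    DirectSum.lof A ℕ (fun n => X n) n - DirectSum.lof A ℕ (fun n => X n) (n + 1) ∘ₗ i n

theorem telescopeMap_apply_zero (y : DirectSum ℕ fun n => X n) : telescopeMap i y 0 = y 0 := by
  suffices DirectSum.component A ℕ (fun n => X n) 0 ∘ₗ telescopeMap i =
    DirectSum.component A ℕ (fun n => X n) 0 from LinearMap.congr_fun this y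
  refine DirectSum.linearMap_ext A fun n => LinearMap.ext fun x => ?_
  simp [telescopeMap, DirectSum.component.of]

theorem telescopeMap_apply_succ (y : DirectSum ℕ fun n => X n) (m : ℕ) :
    telescopeMap i y (m + 1) = y (m + 1) - i m (y m) := by
  suffices DirectSum.component A ℕ (fun n => X n) (m + 1) ∘ₗ telescopeMap i =
      DirectSum.component A ℕ (fun n => X n) (m + 1) -
        i m ∘ₗ DirectSum.component A ℕ (fun n => X n) m from LinearMap.congr_fun this y
  refine DirectSum.linearMap_ext A fun n => LinearMap.ext fun x => ?_
  by_cases h : n = m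
  · subst h
    simp [telescopeMap, DirectSum.component.of]
  · simp [telescopeMap, DirectSum.component.of, h]

theorem telescopeMap_injective : Function.Injective (telescopeMap i) := by
  rw [← LinearMap.ker_eq_bot, LinearMap.ker_eq_bot']
  intro y hy
  refine DFinsupp.ext fun n => ?_
  induction n with
  | zero => rw [← telescopeMap_apply_zero i, hy]
  | succ n ih =>
    have := telescopeMap_apply_succ i y n
    rw [hy, ih] at this
    simpa using this.symm

theorem eq_zero_of_lof_mem_range_telescopeMap (hi : ∀ n, Function.Injective (i n)) (n : ℕ) (x : X n)
    (hx : DirectSum.lof A ℕ (fun n => X n) n x ∈ LinearMap.range (telescopeMap i)) : x = 0 := by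
  obtain ⟨y, hy⟩ := hx
  have hlow (m : ℕ) (hm : m < n) : y m = 0 := by
    induction m with
    | zero =>
      rw [← telescopeMap_apply_zero i, hy]
      exact DFinsupp.single_eq_of_ne hm.ne
    | succ m ih =>
      have := telescopeMap_apply_succ i y m
      rw [hy, ih (by omega), map_zero, sub_zero] at this
      rw [← this]
      exact DFinsupp.single_eq_of_ne hm.ne
  have hn : y n = x := by
    have hxn : DirectSum.lof A ℕ (fun n => X n) n x n = x := DFinsupp.single_eq_same
    rw [← hy] at hxn
    cases n with
    | zero => rw [← hxn, telescopeMap_apply_zero]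
    | succ n => rw [← hxn, telescopeMap_apply_succ, hlow n (by omega), map_zero, sub_zero]
  have hup (m : ℕ) (hm : n ≤ m) : y m = 0 → x = 0 := by
    induction m, hm using Nat.le_induction with
    | base => exact fun h => hn ▸ h
    | succ m hm ih =>
      intro h0
      refine ih (hi m ?_)
      have := telescopeMap_apply_succ i y m
      rw [hy, h0, zero_sub, show DirectSum.lof A ℕ (fun n => X n) n x (m + 1) = 0 from
        DFinsupp.single_eq_of_ne (by omega)] at this
      rw [map_zero, ← neg_eq_zero, ← this]
  classical
  obtain ⟨m, hm⟩ := Infinite.exists_notMem_finset (y.support ∪ Finset.range n)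
  simp only [Finset.mem_union, DFinsupp.mem_support_toFun, Finset.mem_range, not_or, not_not,
    not_lt] at hm
  exact hup m hm.2 hm.1

theorem exists_union (hi : ∀ n, Function.Injective (i n)) :
    ∃ (Y : ModuleCat.{0} A) (c : ∀ n, X n →ₗ[A] Y) (q : (DirectSum ℕ fun n => X n) →ₗ[A] Y),
      (∀ n, Function.Injective (c n)) ∧ (∀ n, c (n + 1) ∘ₗ i n = c n) ∧
      (∀ K : Submodule A Y, K.FG → ∃ n, K ≤ LinearMap.range (c n)) ∧
      Function.Surjective q ∧ LinearMap.range (telescopeMap i) = LinearMap.ker q := by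
  let T := LinearMap.range (telescopeMap i)
  let c (n : ℕ) : X n →ₗ[A] ((DirectSum ℕ fun n => X n) ⧸ T) :=
    T.mkQ ∘ₗ DirectSum.lof A ℕ (fun n => X n) n
  have hc (n : ℕ) : c (n + 1) ∘ₗ i n = c n := by
    refine LinearMap.ext fun x => Eq.symm ((Submodule.Quotient.eq T).2
      ⟨DirectSum.lof A ℕ (fun n => X n) n x, ?_⟩)
    simp [telescopeMap]
  have hmono : Monotone fun n => LinearMap.range (c n) :=
    monotone_nat_of_le_succ fun n => by
      rw [← hc n]
      exact LinearMap.range_comp_le_range _ _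
  have hmem (y : (DirectSum ℕ fun n => X n) ⧸ T) : ∃ n, y ∈ LinearMap.range (c n) := by
    obtain ⟨y, rfl⟩ := T.mkQ_surjective y
    induction y using DirectSum.induction_on with
    | zero => exact ⟨0, by simp⟩
    | of n x => exact ⟨n, x, rfl⟩
    | add x y hx hy =>
      obtain ⟨n, hn⟩ := hx
      obtain ⟨m, hm⟩ := hy
      rw [map_add]
      exact ⟨max n m, add_mem (hmono (le_max_left n m) hn) (hmono (le_max_right n m) hm)⟩
  refine ⟨ModuleCat.of A ((DirectSum ℕ fun n => X n) ⧸ T), c, T.mkQ, fun n => ?_, hc, ?_,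
    T.mkQ_surjective, T.ker_mkQ.symm⟩
  · rw [← LinearMap.ker_eq_bot, LinearMap.ker_eq_bot']
    exact fun x hx => eq_zero_of_lof_mem_range_telescopeMap i hi n x
      ((Submodule.Quotient.mk_eq_zero T).1 hx)
  · rintro K ⟨s, rfl⟩
    choose n hn using hmem
    exact ⟨s.sup n, Submodule.span_le.2 fun y hy => hmono (Finset.le_sup hy) (hn y)⟩

end Telescope

section Step

variable {A : Type} [Ring A]

namespace ProjCoresolution

variable (R : ProjCoresolution A)

theorem exists_exact_directSum [IsNoetherianRing A] [Module.Injective A A]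
    {S : Type} [DecidableEq S] (t : S → ℕ) :
    ∃ (I : ModuleCat.{0} A) (f : (DirectSum S fun s => R.C (t s)) →ₗ[A] I)
      (g : I →ₗ[A] DirectSum S fun s => R.C (t s + 1)),
      Module.Injective A I ∧ Function.Injective f ∧ Function.Surjective g ∧
        LinearMap.range f = LinearMap.ker g := by
  have : Module.Projective A (DirectSum S fun s => R.I (t s)) :=
    inferInstanceAs (Module.Projective A (Π₀ s, R.I (t s)))
  refine ⟨ModuleCat.of A (DirectSum S fun s => R.I (t s)), DirectSum.lmap fun s => R.ι (t s),
    DirectSum.lmap fun s => R.p (t s), injective_of_projective,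
    (DirectSum.lmap_injective _).2 fun s => R.ι_injective (t s),
    (DirectSum.lmap_surjective _).2 fun s => R.p_surjective (t s), ?_⟩
  rw [DirectSum.range_lmap, DirectSum.ker_lmap]
  simp only [R.range_eq_ker]

theorem subsingleton_ext_directSum [IsNoetherianRing A] [Module.Injective A A]
    (hso : SelfOrthogonal A (R.C 0)) {S : Type} [DecidableEq S]
    (t : S → ℕ) (n : ℕ) :
    Subsingleton (Abelian.Ext (R.C 0)
      (ModuleCat.of A (DirectSum S fun s => R.C (t s))) (n + 1)) := by
  induction n generalizing t with
  | zero =>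
    obtain ⟨I, f, g, hI, hf, hg, h⟩ := R.exists_exact_directSum t
    refine subsingleton_ext_one_of_lift
      (Z := ModuleCat.of A (DirectSum S fun s => R.C (t s + 1))) hf hg h (R.C 0) hI fun u => ?_
    obtain ⟨v, -, hv⟩ := (StZero.directSum (fun s => R.stZero_zero hso (t s)) u).exists_lift g hg
    exact ⟨v, hv⟩
  | succ n ih =>
    obtain ⟨I, f, g, hI, hf, hg, h⟩ := R.exists_exact_directSum t
    exact (subsingleton_ext_succ_left_iff_of_injective
      (Z := ModuleCat.of A (DirectSum S fun s => R.C (t s + 1))) hf hg h (R.C 0) hI n).1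
      (ih fun s => t s + 1)

/-- The properties of direct sums of higher cosyzygies needed to control iterated extensions. -/
structure IsOrthogonal (Q : ModuleCat.{0} A) : Prop where
  memS : MemS A (R.C 0) Q
  stZero_zero : StZero A (R.C 0) Q
  stZero_one : StZero A (R.C 1) Q
  subsingleton_ext : ∀ n, Subsingleton (Abelian.Ext (R.C 0) Q (n + 1))

theorem isOrthogonal_directSum [IsNoetherianRing A] [Module.Injective A A]
    (hgen : IsGen A (R.C 0)) (hso : SelfOrthogonal A (R.C 0)) {S : Type}
    [DecidableEq S] (t : S → ℕ) :
    R.IsOrthogonal (ModuleCat.of A (DirectSum S fun s => R.C (t s + 2))) where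
  memS := memS_directSum _ fun _ => R.memS_C hgen _
  stZero_zero := StZero.directSum fun s => R.stZero_zero hso (t s + 1)
  stZero_one := StZero.directSum fun s => R.stZero_one hso (t s)
  subsingleton_ext := R.subsingleton_ext_directSum hso fun s => t s + 2

/-- A sequence of extensions by orthogonal modules, starting from the coresolved module, in which
each step makes the maps from the higher cosyzygies stably trivial. -/
structure Tower where
  /-- the terms of the sequence -/
  X : ℕ → ModuleCat.{0} A
  /-- the cokernels of the inclusions -/
  Q : ℕ → ModuleCat.{0} A
  /-- the identification of the initial term -/
  e : R.C 0 ≃ₗ[A] X 0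
  /-- the inclusions -/
  i : ∀ n, X n →ₗ[A] X (n + 1)
  /-- the projections onto the cokernels -/
  π : ∀ n, X (n + 1) →ₗ[A] Q n
  i_injective : ∀ n, Function.Injective (i n)
  π_surjective : ∀ n, Function.Surjective (π n)
  range_eq_ker : ∀ n, LinearMap.range (i n) = LinearMap.ker (π n)
  isOrthogonal : ∀ n, R.IsOrthogonal (Q n)
  exists_extend : ∀ (n j : ℕ) (u : R.C (j + 1) →ₗ[A] X n),
    ∃ v : R.I (j + 1) →ₗ[A] X (n + 1), v ∘ₗ R.ι (j + 1) = i n ∘ₗ u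

theorem exists_step [IsNoetherianRing A] [Module.Injective A A]
    (hgen : IsGen A (R.C 0)) (hso : SelfOrthogonal A (R.C 0)) (X : ModuleCat.{0} A) :
    ∃ (E Q : ModuleCat.{0} A) (i : X →ₗ[A] E) (π : E →ₗ[A] Q),
      Function.Injective i ∧ Function.Surjective π ∧ LinearMap.range i = LinearMap.ker π ∧
        R.IsOrthogonal Q ∧ ∀ (j : ℕ) (u : R.C (j + 1) →ₗ[A] X),
          ∃ v : R.I (j + 1) →ₗ[A] E, v ∘ₗ R.ι (j + 1) = i ∘ₗ u := by
  classical
  obtain ⟨E, i, π, hi, hπ, h, hE⟩ := exists_pushout_family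
    (S := Σ j : ℕ, (R.C (j + 1) →ₗ[A] X)) (fun s => R.ι_injective (s.1 + 1))
    (fun s => R.p_surjective (s.1 + 1)) (fun s => R.range_eq_ker (s.1 + 1)) fun s => s.2
  exact ⟨E, _, i, π, hi, hπ, h, R.isOrthogonal_directSum hgen hso Sigma.fst,
    fun j u => hE ⟨j, u⟩⟩

theorem exists_tower [IsNoetherianRing A] [Module.Injective A A]
    (hgen : IsGen A (R.C 0)) (hso : SelfOrthogonal A (R.C 0)) :
    Nonempty R.Tower := by
  choose E Q i π hi hπ h hQ hE using R.exists_step hgen hso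
  let X (n : ℕ) : ModuleCat.{0} A := Nat.rec (R.C 0) (fun _ Y => E Y) n
  exact ⟨{
    X := X
    Q := fun n => Q (X n)
    e := LinearEquiv.refl A (R.C 0)
    i := fun n => i (X n)
    π := fun n => π (X n)
    i_injective := fun n => hi (X n)
    π_surjective := fun n => hπ (X n)
    range_eq_ker := fun n => h (X n)
    isOrthogonal := fun n => hQ (X n)
    exists_extend := fun n => hE (X n) }⟩

namespace Tower

variable {R} (T : R.Tower)

theorem π_comp_i (n : ℕ) : T.π n ∘ₗ T.i n = 0 := by
  ext x
  exact (T.range_eq_ker n ▸ LinearMap.mem_range_self (T.i n) x :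
    T.i n x ∈ LinearMap.ker (T.π n))

theorem memS (n : ℕ) : MemS A (R.C 0) (T.X n) := by
  induction n with
  | zero => exact (isSClosedClass_memS _).2.1 _ _ (isSClosedClass_memS _).1 ⟨T.e.toModuleIso⟩
  | succ n ih =>
    exact memS_middle (T.i_injective n) (T.π_surjective n) (T.range_eq_ker n) ih
      (T.isOrthogonal n).memS

theorem subsingleton_ext [IsNoetherianRing A] [Module.Injective A A]
    (hso : SelfOrthogonal A (R.C 0)) (m n : ℕ) :
    Subsingleton (Abelian.Ext (R.C 0) (T.X m) (n + 1)) := by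
  induction m with
  | zero =>
    refine subsingleton_ext_of_sum_comp_eq_id (r := 1) (n + 1)
      (fun _ => ModuleCat.ofHom T.e.symm.toLinearMap) (fun _ => ModuleCat.ofHom T.e.toLinearMap)
      ?_ (R.subsingleton_ext hso 0 n)
    ext x
    simp
  | succ m ih =>
    exact subsingleton_ext_middle (T.i_injective m) (T.π_surjective m) (T.range_eq_ker m) (R.C 0)
      (n + 1) ih ((T.isOrthogonal m).subsingleton_ext n)

/-- The inclusion of the coresolved module into the terms of the sequence. -/
def incl : ∀ n, R.C 0 →ₗ[A] T.X n
  | 0 => T.e.toLinearMap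
  | n + 1 => T.i n ∘ₗ incl n

/-- Every map from the coresolved module to a term of the sequence is stably equal to a map that
factors through the initial term. -/
theorem exists_factorsFree_sub (n : ℕ) (u : R.C 0 →ₗ[A] T.X n) :
    ∃ v : R.C 0 →ₗ[A] R.C 0, FactorsFree (u - T.incl n ∘ₗ v) := by
  induction n with
  | zero =>
    refine ⟨T.e.symm.toLinearMap ∘ₗ u, ?_⟩
    rw [incl, ← LinearMap.comp_assoc, LinearEquiv.comp_symm, LinearMap.id_comp, sub_self]
    exact FactorsFree.zero
  | succ n ih =>
    obtain ⟨w, hw, hwu⟩ := ((T.isOrthogonal n).stZero_zero (T.π n ∘ₗ u)).exists_lift (T.π n)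
      (T.π_surjective n)
    obtain ⟨u', hu'⟩ := exists_comp_eq_of_comp_eq_zero' (T.i_injective n) (T.range_eq_ker n) (u - w)
      (by rw [LinearMap.comp_sub, hwu, sub_self])
    obtain ⟨v, hv⟩ := ih u'
    refine ⟨v, ?_⟩
    have := hw.add (hv.comp_left (T.i n))
    rwa [LinearMap.comp_sub, hu', ← LinearMap.comp_assoc, ← add_sub_assoc,
      add_sub_cancel] at this

theorem exists_extend_of_succ (n : ℕ) (u : R.C 0 →ₗ[A] T.X n) (h : R.I 0 →ₗ[A] T.X (n + 1))
    (hu : h ∘ₗ R.ι 0 = T.i n ∘ₗ u) : ∃ v : R.I 0 →ₗ[A] T.X n, v ∘ₗ R.ι 0 = u := by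
  obtain ⟨w, hw⟩ := exists_comp_eq_of_comp_eq_zero (R.p_surjective 0) (R.range_eq_ker 0)
    (T.π n ∘ₗ h) (by
      rw [LinearMap.comp_assoc, hu, ← LinearMap.comp_assoc, T.π_comp_i, LinearMap.zero_comp])
  obtain ⟨w', -, hw'⟩ := ((T.isOrthogonal n).stZero_one w).exists_lift (T.π n) (T.π_surjective n)
  obtain ⟨v, hv⟩ := exists_comp_eq_of_comp_eq_zero' (T.i_injective n) (T.range_eq_ker n)
    (h - w' ∘ₗ R.p 0) (by rw [LinearMap.comp_sub, ← LinearMap.comp_assoc, hw', hw, sub_self])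
  refine ⟨v, (LinearMap.cancel_left (T.i_injective n)).1 ?_⟩
  rw [← LinearMap.comp_assoc, hv, LinearMap.sub_comp, hu, LinearMap.comp_assoc, R.p_comp_ι,
    LinearMap.comp_zero, sub_zero]

theorem projective_of_extend (n : ℕ) (h : R.I 0 →ₗ[A] T.X n)
    (hh : h ∘ₗ R.ι 0 = T.incl n) : Module.Projective A (R.C 0) := by
  induction n with
  | zero =>
    refine Module.Projective.of_split (R.ι 0) (T.e.symm.toLinearMap ∘ₗ h) ?_
    rw [LinearMap.comp_assoc, hh, incl, LinearEquiv.symm_comp]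
  | succ n ih =>
    obtain ⟨v, hv⟩ := T.exists_extend_of_succ n (T.incl n) h hh
    exact ih v hv

end Tower

end ProjCoresolution

end Step

section Limit

variable {A : Type} [Ring A] [IsNoetherianRing A] [Module.Injective A A]

namespace ProjCoresolution

variable (R : ProjCoresolution A)

theorem exists_orthogonal_extension (hgen : IsGen A (R.C 0)) (hso : SelfOrthogonal A (R.C 0)) :
    ∃ (X : ModuleCat.{0} A) (c : R.C 0 →ₗ[A] X), MemS A (R.C 0) X ∧
      (∀ n, Subsingleton (Abelian.Ext (R.C 0) X (n + 1))) ∧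
      (∀ j, StZero A (R.C (j + 1)) X) ∧
      (∀ u : R.C 0 →ₗ[A] X, ∃ v : R.C 0 →ₗ[A] R.C 0, FactorsFree (u - c ∘ₗ v)) ∧
      (FactorsFree c → Module.Projective A (R.C 0)) := by
  obtain ⟨T⟩ := R.exists_tower hgen hso
  obtain ⟨X, c, q, hc, hci, hfg, hq, hex⟩ := exists_union T.i T.i_injective
  have hlift {N : ModuleCat.{0} A} [Module.Finite A N] (u : N →ₗ[A] X) :
      ∃ (n : ℕ) (v : N →ₗ[A] T.X n), c n ∘ₗ v = u := by
    obtain ⟨n, hn⟩ := hfg (LinearMap.range u) (Submodule.fg_range u)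
    obtain ⟨v, hv⟩ := exists_comp_eq_of_comp_eq_zero' (hc n)
      (LinearMap.range (c n)).ker_mkQ.symm u (LinearMap.ext fun x =>
        (Submodule.Quotient.mk_eq_zero _).2 (hn (LinearMap.mem_range_self u x)))
    exact ⟨n, v, hv⟩
  have hincl (n : ℕ) : c n ∘ₗ T.incl n = c 0 ∘ₗ T.incl 0 := by
    induction n with
    | zero => rfl
    | succ n ih => rw [← ih, Tower.incl, ← LinearMap.comp_assoc, hci]
  have hS := memS_directSum T.X T.memS
  refine ⟨X, c 0 ∘ₗ T.incl 0, memS_right (telescopeMap_injective T.i) hq hex hS hS, fun n => ?_,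
    fun j u => ?_, fun u => ?_, fun h => ?_⟩
  · refine subsingleton_ext_of_locally n (R.C 0) X fun K hK => ?_
    obtain ⟨m, hm⟩ := hfg K hK
    exact ⟨T.X m, c m, hc m, hm, T.subsingleton_ext hso m n⟩
  · obtain ⟨n, v, rfl⟩ := hlift u
    obtain ⟨w, hw⟩ := T.exists_extend n j v
    have := factorsFree_comp_of_projective (R.ι (j + 1)) (c (n + 1) ∘ₗ w)
    rwa [LinearMap.comp_assoc, hw, ← LinearMap.comp_assoc, hci] at this
  · obtain ⟨n, w, rfl⟩ := hlift u
    obtain ⟨v, hv⟩ := T.exists_factorsFree_sub n w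
    refine ⟨v, ?_⟩
    have := hv.comp_left (c n)
    rwa [LinearMap.comp_sub, ← LinearMap.comp_assoc, hincl] at this
  · obtain ⟨g, hg⟩ := h.exists_extend (R.ι 0) (R.ι_injective 0)
    obtain ⟨n, v, rfl⟩ := hlift g
    refine T.projective_of_extend n v ((LinearMap.cancel_left (hc n)).1 ?_)
    rw [← LinearMap.comp_assoc, hg, hincl n]

end ProjCoresolution

end Limit

section Conclusion

variable {k A : Type} [Field k] [Ring A] [Algebra k A]

theorem MemAdd.exists_sum_comp_eq_id {N M : ModuleCat.{0} A} (h : MemAdd A N M) :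
    ∃ (r : ℕ) (a : Fin r → M →ₗ[A] N) (b : Fin r → N →ₗ[A] M),
      ∑ i, b i ∘ₗ a i = LinearMap.id := by
  obtain ⟨r, Y, ⟨e⟩⟩ := h
  refine ⟨r, fun i => LinearMap.proj i ∘ₗ e.toLinearMap ∘ₗ LinearMap.inl A M Y,
    fun i => LinearMap.fst A M Y ∘ₗ e.symm.toLinearMap ∘ₗ LinearMap.single A (fun _ => N) i,
    LinearMap.ext fun x => ?_⟩
  have : ∑ i, Pi.single (M := fun _ => N) i (e (x, 0) i) = e (x, 0) :=
    Finset.univ_sum_single (e (x, 0))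
  have h2 := congrArg (fun y => (e.symm y).1) this
  simpa [LinearMap.sum_apply, map_sum, Prod.fst_sum] using h2

theorem NakayamaStable.memAdd_nuMod {M : ModuleCat.{0} A} (hns : NakayamaStable k A M) :
    MemAdd A (NuMod k A M) M :=
  (hns M).1 ⟨1, ModuleCat.of A PUnit,
    ⟨LinearEquiv.prodUnique.trans (LinearEquiv.funUnique (Fin 1) A M).symm⟩⟩

theorem stHomProjFinDim_of_factorsFree_sub [FiniteDimensional k A] {M X : ModuleCat.{0} A}
    [Module.Finite A M] (c : M →ₗ[A] X)
    (h : ∀ u : M →ₗ[A] X, ∃ v : M →ₗ[A] M, FactorsFree (u - c ∘ₗ v)) :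
    StHomProjFinDim k A M X := by
  let := Module.compHom M (algebraMap k A)
  have : IsScalarTower k A M := IsScalarTower.of_algebraMap_smul fun _ _ => rfl
  have : Module.Finite k M := Module.Finite.trans A M
  have : Module.Finite k (M →ₗ[A] M) :=
    Module.Finite.of_injective (LinearMap.restrictScalarsₗ k A M M k)
      (LinearMap.restrictScalars_injective k)
  let b := Module.finBasis k (M →ₗ[A] M)
  refine ⟨_, fun j => ModuleCat.ofHom (c ∘ₗ b j), fun g => ?_⟩
  obtain ⟨v, hv⟩ := h g.hom
  refine ⟨fun j => b.repr v j, (factorsThroughProj_iff _).2 ?_⟩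
  convert hv using 1
  ext x
  have hx := LinearMap.congr_fun (b.sum_repr v) x
  rw [LinearMap.sum_apply] at hx
  rw [ModuleCat.hom_sub, LinearMap.sub_apply, LinearMap.sub_apply, LinearMap.comp_apply, ← hx,
    map_sum, ModuleCat.hom_sum, LinearMap.sum_apply]
  congr 1
  refine Finset.sum_congr rfl fun j _ => ?_
  exact congrArg c ((b j).map_smul (algebraMap k A (b.repr v j)) x)

namespace ProjCoresolution

variable (R : ProjCoresolution A) {X : ModuleCat.{0} A}

theorem subsingleton_ext_nuMod [Module.Injective A A] (hX : ∀ j, StZero A (R.C (j + 1)) X)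
    (j n : ℕ) : Subsingleton (Abelian.Ext X (NuMod k A (R.C j)) (n + 1)) := by
  let := Module.compHom X (algebraMap k A)
  have : IsScalarTower k A X := IsScalarTower.of_algebraMap_smul fun _ _ => rfl
  have hf := nuMap_injective k (R.ι j) (R.ι_injective j)
  have hg := nuMap_surjective k (R.p j) (R.p_surjective j)
  have h := range_nuMap_eq_ker k (R.p_surjective j) (R.range_eq_ker j)
  induction n generalizing j with
  | zero =>
    refine subsingleton_ext_one_of_lift (X := NuMod k A (R.C j)) (Y := NuMod k A (R.I j))
      (Z := NuMod k A (R.C (j + 1))) hf hg h X injective_nuCarrier ?_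
    exact exists_nuMap_comp_eq (R.ι_injective (j + 1)) (R.p_surjective (j + 1))
      (R.range_eq_ker (j + 1)) (hX (j + 1)) (R.p j) (R.p_surjective j)
  | succ n ih =>
    exact (subsingleton_ext_succ_left_iff_of_injective (X := NuMod k A (R.C j))
      (Y := NuMod k A (R.I j)) (Z := NuMod k A (R.C (j + 1))) hf hg h X injective_nuCarrier n).1
      (ih (j + 1) (nuMap_injective k _ (R.ι_injective _)) (nuMap_surjective k _ (R.p_surjective _))
        (range_nuMap_eq_ker k (R.p_surjective _) (R.range_eq_ker _)))

theorem subsingleton_ext_right [Module.Injective A A] (hns : NakayamaStable k A (R.C 0))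
    (hX : ∀ j, StZero A (R.C (j + 1)) X) (n : ℕ) :
    Subsingleton (Abelian.Ext X (R.C 0) (n + 1)) := by
  obtain ⟨r, a, b, hab⟩ := hns.memAdd_nuMod.exists_sum_comp_eq_id
  refine subsingleton_ext_of_sum_comp_eq_id (n + 1) (fun i => ModuleCat.ofHom (a i))
    (fun i => ModuleCat.ofHom (b i)) ?_ (R.subsingleton_ext_nuMod (k := k) hX 0 n)
  ext x
  simpa [ModuleCat.hom_sum] using LinearMap.congr_fun hab x

/-- If `StHom(Ω⁻¹ M, X) = 0`, then every composite `M → X → M` is stably trivial. -/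
theorem factorsFree_comp [IsNoetherianRing A] [Module.Injective A A]
    (hns : NakayamaStable k A (R.C 0)) (hX : StZero A (R.C 1) X) (c : R.C 0 →ₗ[A] X)
    (f : X →ₗ[A] R.C 0) : FactorsFree (f ∘ₗ c) := by
  let := Module.compHom X (algebraMap k A)
  have : IsScalarTower k A X := IsScalarTower.of_algebraMap_smul fun _ _ => rfl
  obtain ⟨r, a, b, hab⟩ := hns.memAdd_nuMod.exists_sum_comp_eq_id
  obtain ⟨m, q, hq⟩ := Module.Finite.exists_fin' A (R.C 0)
  have hI : Module.Injective A (NuCarrier k A (Fin m → A)) := injective_nuCarrier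
  have key (i : Fin r) : FactorsFree (b i ∘ₗ a i ∘ₗ f ∘ₗ c) := by
    obtain ⟨Φ, hΦ⟩ := exists_nuMap_comp_eq (k := k) (R.ι_injective 0) (R.p_surjective 0)
      (R.range_eq_ker 0) hX q hq (a i ∘ₗ f)
    obtain ⟨w, hw⟩ := hI.out (R.ι 0) (R.ι_injective 0) (Φ ∘ₗ c)
    have hac : a i ∘ₗ f ∘ₗ c = (nuMap k q ∘ₗ w) ∘ₗ R.ι 0 := LinearMap.ext fun x =>
      (LinearMap.congr_fun hΦ (c x)).symm.trans (congrArg (nuMap k q) (hw x).symm)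
    rw [hac]
    exact (factorsFree_comp_of_projective _ _).comp_left (b i)
  have hsum : f ∘ₗ c = ∑ i, b i ∘ₗ a i ∘ₗ f ∘ₗ c := by
    ext x
    simpa using (LinearMap.congr_fun hab (f (c x))).symm
  rw [hsum]
  exact FactorsFree.sum _ key

theorem factorsFree_of_memAddBig [IsNoetherianRing A] [Module.Injective A A]
    (hns : NakayamaStable k A (R.C 0)) (hX : StZero A (R.C 1) X) (hadd : MemAddBig A (R.C 0) X)
    (c : R.C 0 →ₗ[A] X) : FactorsFree c := by
  obtain ⟨J, i, r, hr⟩ := hadd.exists_retract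
  obtain ⟨s, hs⟩ := exists_eq_sum_finsupp (i ∘ₗ c)
  have hic : FactorsFree (i ∘ₗ c) := by
    rw [hs]
    exact FactorsFree.sum s fun j =>
      (R.factorsFree_comp hns hX c (Finsupp.lapply j ∘ₗ i)).comp_left (Finsupp.lsingle j)
  have := hic.comp_left r
  rwa [← LinearMap.comp_assoc, hr, LinearMap.id_comp] at this

theorem projective_of_forall_memE [FiniteDimensional k A] [IsNoetherianRing A]
    [Module.Injective A A] (hgen : IsGen A (R.C 0)) (hso : SelfOrthogonal A (R.C 0))
    (hns : NakayamaStable k A (R.C 0))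
    (h : ∀ X : ModuleCat.{0} A, MemE k A (R.C 0) (R.C 1) X → MemS A (R.C 0) X →
      MemAddBig A (R.C 0) X) : Module.Projective A (R.C 0) := by
  obtain ⟨X, c, hS, hext, hst, hsub, hproj⟩ := R.exists_orthogonal_extension hgen hso
  refine hproj (R.factorsFree_of_memAddBig hns (hst 0) (h X ⟨fun n hn => ?_,
    stHomProjFinDim_of_factorsFree_sub c hsub, 0, Fin.elim0, fun g => ⟨Fin.elim0, ?_⟩⟩ hS) c)
  · obtain ⟨n, rfl⟩ := Nat.exists_eq_add_of_le' hn
    exact ⟨(extZero_succ_iff_subsingleton n _ _).2 (hext n),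
      (extZero_succ_iff_subsingleton n _ _).2 (R.subsingleton_ext_right hns hst n)⟩
  · exact (factorsThroughProj_iff _).2 (hst 0 _)

end ProjCoresolution

end Conclusion

/-- **Corollary (vanishing of the relative stable categories)**. `M` is projective iff every
module in `𝒢 ∩ 𝒮` lies in `Add M`, iff every module in `ℰ ∩ 𝒮` lies in `Add M`.
Here `C` is the cosyzygy sequence of `M` along a minimal injective coresolution, so that
`C 1 = Ω_A^{-1}(M)`. -/
theorem projective_iff_G_inter_S_in_AddM_iff_E_inter_S_in_AddM
    (k A : Type) [Field k] [Ring A] [Algebra k A] [FiniteDimensional k A]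
    [Module.Injective A A]
    (M : ModuleCat.{0} A) [Module.Finite A ↥M]
    (hgen : IsGen A M) (hso : SelfOrthogonal A M) (hns : NakayamaStable k A M)
    (C : ℕ → ModuleCat.{0} A) (hC : IsMinInjCoresolution A M C) :
    (Module.Projective A ↥M ↔
      ∀ X : ModuleCat.{0} A, MemG A M X → MemS A M X → MemAddBig A M X) ∧
    (Module.Projective A ↥M ↔
      ∀ X : ModuleCat.{0} A, MemE k A M (C 1) X → MemS A M X → MemAddBig A M X) := by
  have : IsNoetherianRing A := isNoetherian_of_tower k inferInstance
  have : IsArtinianRing A := isArtinian_of_tower k inferInstance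
  have hforward (hM : Module.Projective A M) (X : ModuleCat.{0} A) (hX : MemS A M X) :
      MemAddBig A M X := memAddBig_of_memS_of_projective hgen hX
  have hE (h : ∀ X : ModuleCat.{0} A, MemE k A M (C 1) X → MemS A M X → MemAddBig A M X) :
      Module.Projective A M := by
    obtain ⟨R, rfl, h1⟩ := hC.exists_projCoresolution
    rw [← h1] at h
    exact R.projective_of_forall_memE hgen hso hns h
  exact ⟨⟨fun hM X _ => hforward hM X, fun h => hE fun X hX => h X hX.1⟩,
    ⟨fun hM X _ => hforward hM X, hE⟩⟩
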